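/- arXiv:1509.03131 — 3 statements merged into one kernel-verified Lean document; each statement's English description precedes it below -/
import Mathlib

section
/- The Higman group H_4 on four generators is acylindrically hyperbolic: H_4 is not virtually cyclic and there exist a geodesic Gromov-hyperbolic metric space X and an isometric action of H_4 on X that is acylindrical and has an unbounded orbit. -/
def higmanRels (n : ℕ) : Set (FreeGroup (ZMod n)) :=
  {r | ∃ i : ZMod n,
    r = FreeGroup.of i * FreeGroup.of (i + 1) * (FreeGroup.of i)⁻¹ * ((FreeGroup.of (i + 1))⁻¹) ^ 2}

abbrev HigmanGroup (n : ℕ) : Type := PresentedGroup (higmanRels n)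

def IsGeodesicSpace (X : Type*) [MetricSpace X] : Prop :=
  ∀ x y : X, ∃ γ : ℝ → X, γ 0 = x ∧ γ (dist x y) = y ∧
    ∀ s ∈ Set.Icc (0 : ℝ) (dist x y), ∀ t ∈ Set.Icc (0 : ℝ) (dist x y),
      dist (γ s) (γ t) = |s - t|

def IsGromovHyperbolic (X : Type*) [MetricSpace X] : Prop :=
  ∃ δ : ℝ, 0 ≤ δ ∧ ∀ x y z w : X,
    (dist x w + dist z w - dist x z) / 2 ≥
      min ((dist x w + dist y w - dist x y) / 2) ((dist y w + dist z w - dist y z) / 2) - δ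

def IsAcylindricalAction {G X : Type*} [Group G] [MetricSpace X] (act : G → X → X) : Prop :=
  ∀ r : ℝ, 0 ≤ r → ∃ (L : ℝ) (N : ℕ), 0 ≤ L ∧ ∀ x y : X, L ≤ dist x y →
    {g : G | dist x (act g x) ≤ r ∧ dist y (act g y) ≤ r}.Finite ∧
    {g : G | dist x (act g x) ≤ r ∧ dist y (act g y) ≤ r}.ncard ≤ N

def IsVirtuallyCyclic (G : Type*) [Group G] : Prop :=
  ∃ H : Subgroup G, IsCyclic H ∧ H.FiniteIndex

def GoodAcylAction (G : Type*) [Group G] (X : Type*) [MetricSpace X] (act : G → X → X) : Prop :=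
  (∀ g : G, Isometry (act g)) ∧
  (∀ x : X, act 1 x = x) ∧
  (∀ (g h : G) (x : X), act (g * h) x = act g (act h x)) ∧
  IsGeodesicSpace X ∧ IsGromovHyperbolic X ∧ IsAcylindricalAction act ∧
  ∃ x : X, ¬ Bornology.IsBounded (Set.range fun g : G => act g x)

def IsAcylindricallyHyperbolic (G : Type*) [Group G] : Prop :=
  ¬ IsVirtuallyCyclic G ∧
  ∃ (X : Type) (m : MetricSpace X) (act : G → X → X), @GoodAcylAction G _ X m act

/-- `SyllableDecomposition C K P` says that a group is the amalgam of its subgroups `K i` along `C`: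
it is partitioned into `C` and the sets `P i` of elements whose reduced forms begin with a syllable
in `K i`. -/
structure SyllableDecomposition {ι G : Type*} [Group G] (C : Subgroup G) (K : ι → Subgroup G)
    (P : ι → Set G) : Prop where
  base_le : ∀ i, C ≤ K i
  disjoint : ∀ {i j g}, g ∈ P i → g ∈ P j → i = j
  notMem_of_mem_base : ∀ {i g}, g ∈ C → g ∉ P i
  base_mul_mem : ∀ {i c g}, c ∈ C → g ∈ P i → c * g ∈ P i
  mul_mem : ∀ {i x r}, x ∈ K i → x ∉ C → r ∉ P i → x * r ∈ P i
  induction : ∀ Φ : G → Prop, (∀ c ∈ C, Φ c) →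
    (∀ i x r, x ∈ K i → x ∉ C → r ∉ P i → Φ r → Φ (x * r)) → ∀ g, Φ g

/-- The pushout of injective group homomorphisms is the amalgam of its factors. -/
theorem Monoid.PushoutI.exists_syllableDecomposition {ι H : Type*} {G : ι → Type*}
    [∀ i, Group (G i)] [Group H] {φ : ∀ i, H →* G i} (hφ : ∀ i, Function.Injective (φ i)) :
    ∃ P : ι → Set (Monoid.PushoutI φ), SyllableDecomposition (Monoid.PushoutI.base φ).range
      (fun i => (Monoid.PushoutI.of (φ := φ) i).range) P := by
  classical
  obtain ⟨d⟩ := NormalWord.transversal_nonempty φ hφ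
  have hof : ∀ {i : ι} {g : G i}, of (φ := φ) i g ∉ (base φ).range → g ∉ (φ i).range := by
    rintro i g hg ⟨h, rfl⟩
    exact hg ⟨h, (of_apply_eq_base φ i h).symm⟩
  have hsurj : ∀ g : Monoid.PushoutI φ, ∃ w : NormalWord d, w.prod = g := fun g =>
    ⟨NormalWord.equiv g, NormalWord.equiv.symm_apply_apply g⟩
  have hinj : Function.Injective (NormalWord.prod : NormalWord d → _) := NormalWord.prod_injective
  refine ⟨fun i => {g | ∃ w : NormalWord d, w.prod = g ∧ w.toWord.fstIdx = some i}, ?_⟩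
  constructor
  · rintro i _ ⟨h, rfl⟩
    exact ⟨φ i h, of_apply_eq_base φ i h⟩
  · rintro i j _ ⟨w, rfl, hw⟩ ⟨w', hww', hw'⟩
    rw [hinj hww', hw] at hw'
    exact Option.some_injective _ hw'
  · rintro i _ ⟨h, rfl⟩ ⟨w, hw, hwi⟩
    have : w = h • NormalWord.empty := hinj (by rw [hw, NormalWord.prod_base_smul]; simp)
    subst this
    simp [NormalWord.base_smul_def', CoprodI.Word.fstIdx, NormalWord.empty] at hwi
  · rintro i _ _ ⟨h, rfl⟩ ⟨w, rfl, hw⟩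
    exact ⟨h • w, NormalWord.prod_base_smul h w, hw⟩
  · rintro i _ r ⟨x, rfl⟩ hx hr
    obtain ⟨w, rfl⟩ := hsurj r
    have hw : w.toWord.fstIdx ≠ some i := fun h => hr ⟨w, rfl, h⟩
    refine ⟨NormalWord.cons x w hw (hof hx), NormalWord.prod_cons _ _ _ _, ?_⟩
    simp [NormalWord.cons, CoprodI.Word.cons, CoprodI.Word.fstIdx]
  · intro Φ hbase hmul g
    obtain ⟨w, rfl⟩ := hsurj g
    suffices ∀ h, Φ (base φ h * w.prod) by simpa using this 1
    induction w using NormalWord.consRecOn with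
    | empty => exact fun h => by simpa using hbase _ ⟨h, rfl⟩
    | cons i x w hw _ hx _ ih =>
      intro h
      have key : base φ h * (of i x * w.prod) = of i (φ i h * x) * w.prod := by
        rw [map_mul, of_apply_eq_base, mul_assoc]
      rw [NormalWord.prod_cons, key]
      refine hmul i _ _ ⟨_, rfl⟩ ?_ ?_ (by simpa using ih 1)
      · rintro ⟨h', hh'⟩
        rw [← of_apply_eq_base φ i] at hh'
        refine hx ((Subgroup.mul_mem_cancel_left (φ i).range ⟨h, rfl⟩).1 ⟨h', of_injective hφ i hh'⟩)
      · rintro ⟨w', hww', hw'⟩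
        rw [hinj hww'] at hw'
        exact hw hw'
    | base h' w _ ih =>
      intro h
      simpa [mul_assoc] using ih (h * h')

/-- A tree-like structure on `V`: `E v x y` says that `x` and `y` lie in the same branch at `v`, and
`Big v x y` that the branches of `x` and `y` at `v` are distinct and form a distinguished angle. -/
structure BranchSystem {V : Type*} (E Big : V → V → V → Prop) : Prop where
  refl : ∀ {v x}, x ≠ v → E v x x
  ne : ∀ {v x y}, E v x y → x ≠ v
  symm : ∀ {v x y}, E v x y → E v y x
  trans : ∀ {v x y z}, E v x y → E v y z → E v x z
  big_symm : ∀ {v x y}, Big v x y → Big v y x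
  big_ne : ∀ {v x y}, Big v x y → x ≠ v
  big_not : ∀ {v x y}, Big v x y → ¬ E v x y
  big_congr : ∀ {v x x' y}, E v x x' → Big v x y → Big v x' y
  total : ∀ {v w} x, v ≠ w → E v x w ∨ E w x v
  finite : ∀ x y, {v | ¬ E v x y}.Finite

namespace BranchSystem

variable {V : Type*} {E Big : V → V → V → Prop}

theorem big_congr_right (h : BranchSystem E Big) {v x y y' : V} (hy : E v y y')
    (hb : Big v x y) : Big v x y' :=
  h.big_symm (h.big_congr hy (h.big_symm hb))

theorem finite_big (h : BranchSystem E Big) (x y : V) : {v | Big v x y}.Finite :=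
  (h.finite x y).subset fun _ hv => h.big_not hv

theorem finite_big_and (h : BranchSystem E Big) (x y : V) (p : V → Prop) :
    {v | Big v x y ∧ p v}.Finite :=
  (h.finite_big x y).subset fun _ hv => hv.1

theorem not_big_self (h : BranchSystem E Big) (v x : V) : ¬ Big v x x := fun hb =>
  h.big_not hb (h.refl (h.big_ne hb))

/-- The number of distinguished angles between two points. -/
noncomputable def angleCount (Big : V → V → V → Prop) (x y : V) : ℕ := {v | Big v x y}.ncard

theorem angleCount_self (h : BranchSystem E Big) (x : V) : angleCount Big x x = 0 := by
  simp [angleCount, h.not_big_self]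

theorem angleCount_comm (h : BranchSystem E Big) (x y : V) :
    angleCount Big x y = angleCount Big y x := by
  unfold angleCount
  congr 1
  ext v
  exact ⟨h.big_symm, h.big_symm⟩

/-- The number of distinguished angles separating `w` from both `x` and `y`. -/
noncomputable def commonCount (E Big : V → V → V → Prop) (w x y : V) : ℕ :=
  {v | Big v w x ∧ E v x y}.ncard

theorem commonCount_comm (h : BranchSystem E Big) (w x y : V) :
    commonCount E Big w x y = commonCount E Big w y x := by
  unfold commonCount
  congr 1
  ext v
  exact ⟨fun hv => ⟨h.big_congr_right hv.2 hv.1, h.symm hv.2⟩,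
    fun hv => ⟨h.big_congr_right hv.2 hv.1, h.symm hv.2⟩⟩

/-- At most one angle on `[x, z]` has `y` in neither of its two branches. -/
theorem subsingleton_big_of_not (h : BranchSystem E Big) (x y z : V) :
    {v | Big v x z ∧ ¬ E v x y ∧ ¬ E v z y}.Subsingleton := by
  rintro v ⟨hv, hvx, hvz⟩ w ⟨hw, hwx, hwz⟩
  by_contra hne
  have hv' := h.big_not hv
  have hw' := h.big_not hw
  rcases h.total x hne with h1 | h1 <;> rcases h.total y hne with h2 | h2 <;>
    rcases h.total z hne with h3 | h3
  all_goals first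
    | exact hvx (h.trans h1 (h.symm h2))
    | exact hwx (h.trans h1 (h.symm h2))
    | exact hvz (h.trans h3 (h.symm h2))
    | exact hwz (h.trans h3 (h.symm h2))
    | exact hv' (h.trans h1 (h.symm h3))
    | exact hw' (h.trans h1 (h.symm h3))

theorem exists_angleCount_eq (h : BranchSystem E Big) (x y z : V) :
    ∃ ε ≤ 1, angleCount Big x z = commonCount E Big z x y + commonCount E Big x y z + ε := by
  refine ⟨{v | Big v x z ∧ ¬ E v x y ∧ ¬ E v z y}.ncard,
    (Set.ncard_le_one (h.finite_big_and _ _ _)).2 fun a ha b hb =>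
      h.subsingleton_big_of_not x y z ha hb, ?_⟩
  have e1 : commonCount E Big x y z = {v | Big v x z ∧ E v z y}.ncard := h.commonCount_comm _ _ _
  have e2 : commonCount E Big z x y = {v | Big v x z ∧ E v x y}.ncard := by
    unfold commonCount
    congr 1
    ext v
    exact and_congr_left fun _ => ⟨h.big_symm, h.big_symm⟩
  rw [e1, e2, angleCount, ← Set.ncard_union_eq _ (h.finite_big_and _ _ _) (h.finite_big_and _ _ _),
    ← Set.ncard_union_eq _ ((h.finite_big_and _ _ _).union (h.finite_big_and _ _ _))
      (h.finite_big_and _ _ _)]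
  · congr 1
    ext v
    simp only [Set.mem_ofPred_eq, Set.mem_union]
    tauto
  · rw [Set.disjoint_left]
    simp only [Set.mem_ofPred_eq, Set.mem_union]
    tauto
  · rw [Set.disjoint_left]
    rintro v ⟨hb, h1⟩ ⟨_, h2⟩
    exact h.big_not hb (h.trans h1 (h.symm h2))

theorem commonCount_le (h : BranchSystem E Big) (w x y : V) :
    commonCount E Big w x y ≤ angleCount Big w x :=
  Set.ncard_le_ncard (fun _ hv => hv.1) (h.finite_big w x)

theorem angleCount_triangle (h : BranchSystem E Big) (x y z : V) :
    angleCount Big x z ≤ angleCount Big x y + angleCount Big y z + 1 := by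
  obtain ⟨ε, hε, he⟩ := h.exists_angleCount_eq x y z
  have h1 := h.commonCount_le x y z
  have h2 := h.commonCount_le z y x
  rw [h.commonCount_comm z y x, h.angleCount_comm z y] at h2
  omega

theorem min_commonCount_le (h : BranchSystem E Big) (w x y z : V) :
    min (commonCount E Big w x y) (commonCount E Big w y z) ≤ commonCount E Big w x z := by
  by_contra! hlt
  obtain ⟨h1, h2⟩ := lt_min_iff.1 hlt
  have hsub : ∀ {a b : V}, commonCount E Big w x z < {v | Big v w a ∧ E v a b}.ncard →
      ∃ v, (Big v w a ∧ E v a b) ∧ ¬ (Big v w x ∧ E v x z) := by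
    intro a b hab
    by_contra! hcon
    exact hab.not_ge (Set.ncard_le_ncard hcon (h.finite_big_and _ _ _))
  obtain ⟨v, ⟨hvw, hvx⟩, hv⟩ := hsub h1
  obtain ⟨u, ⟨huw, huy⟩, hu⟩ := hsub h2
  have hvz : ¬ E v x z := fun hz => hv ⟨hvw, hz⟩
  have hux : ¬ E u z x := fun hx =>
    hu ⟨h.big_congr_right (h.trans huy hx) huw, h.symm hx⟩
  have hvw' : ¬ E v w x := h.big_not hvw
  have huw' : ¬ E u w y := h.big_not huw
  have hne : v ≠ u := by
    rintro rfl
    exact hvz (h.trans hvx huy)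
  have tr : ∀ {a p q r}, E a p r → E a q r → E a p q := fun hp hq => h.trans hp (h.symm hq)
  rcases h.total y hne with hy | hy
  · have h3 := (h.total w hne).resolve_left fun hw => hvw' (tr hw (h.trans hvx hy))
    have h4 := (h.total z hne).resolve_left fun hz => hvz (h.trans hvx (tr hy hz))
    exact huw' (tr h3 (h.trans huy h4))
  · have h3 := (h.total x hne).resolve_right fun hx => hux (tr (h.trans (h.symm huy) hy) hx)
    have h4 := (h.total w hne).resolve_right fun hw => huw' (tr hw hy)
    exact hvw' (tr h4 h3)

theorem big_of_big_of_big (h : BranchSystem E Big) {x y u v : V} (hv : Big v x y)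
    (hu : Big u x v) : Big u x y := by
  have hne : u ≠ v := (h.big_ne (h.big_symm hu)).symm
  rcases h.total y hne with hy | hy
  · exact h.big_congr_right (h.symm hy) hu
  · have hx := (h.total x hne).resolve_left (h.big_not hu)
    exact absurd (h.trans hx (h.symm hy)) (h.big_not hv)

/-- The angles between `x` and an angle `v` on `[x, y]` are strictly fewer than those on
`[x, y]`. -/
theorem angleCount_lt (h : BranchSystem E Big) {x y v : V} (hv : Big v x y) :
    angleCount Big x v < angleCount Big x y :=
  Set.ncard_lt_ncard ⟨fun _ => h.big_of_big_of_big hv,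
    fun hsub => h.big_ne (h.big_symm (hsub hv)) rfl⟩ (h.finite_big x y)

/-- Distinct angles on `[x, y]` are at distinct distances from `x`. -/
theorem angleCount_injOn (h : BranchSystem E Big) (x y : V) :
    Set.InjOn (angleCount Big x) {v | Big v x y} := by
  intro u hu v hv huv
  by_contra hne
  have hu' := h.big_not hu
  have hv' := h.big_not hv
  rcases h.total y hne with hy | hy
  · exact (h.angleCount_lt (h.big_congr_right hy hu)).ne huv
  · exact (h.angleCount_lt (h.big_congr_right hy hv)).ne huv.symm

theorem exists_angleCount_eq_zero (h : BranchSystem E Big) {x y : V}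
    (hxy : 0 < angleCount Big x y) :
    ∃ v, angleCount Big x v = 0 ∧ angleCount Big v y < angleCount Big x y := by
  obtain ⟨v, hv, hmin⟩ := exists_minimalFor_of_wellFoundedLT (fun v => Big v x y)
    (angleCount Big x) ((Set.ncard_pos (h.finite_big x y)).1 hxy)
  refine ⟨v, ?_, ?_⟩
  · rw [angleCount, Set.ncard_eq_zero (h.finite_big x v), Set.eq_empty_iff_forall_notMem]
    intro u hu
    have := hmin (h.big_of_big_of_big hv hu) (h.angleCount_lt hu).le
    exact (h.angleCount_lt hu).not_ge this
  · rw [h.angleCount_comm v y, h.angleCount_comm x y]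
    exact h.angleCount_lt (h.big_symm hv)

/-- The combinatorial distance obtained from the number of distinguished angles. -/
noncomputable def angleDist (Big : V → V → V → Prop) (x y : V) : ℕ :=
  open Classical in if x = y then 0 else angleCount Big x y + 1

theorem angleDist_eq_zero {x y : V} : angleDist Big x y = 0 ↔ x = y := by
  unfold angleDist
  split_ifs <;> simp_all

theorem angleDist_comm (h : BranchSystem E Big) (x y : V) :
    angleDist Big x y = angleDist Big y x := by
  by_cases hxy : x = y
  · rw [hxy]
  · simp [angleDist, hxy, Ne.symm hxy, h.angleCount_comm x y]

theorem angleDist_triangle (h : BranchSystem E Big) (x y z : V) :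
    angleDist Big x z ≤ angleDist Big x y + angleDist Big y z := by
  have := h.angleCount_triangle x y z
  unfold angleDist
  split_ifs <;> first | omega | (subst_vars; omega) | (subst_vars; contradiction)

theorem angleCount_le_angleDist (h : BranchSystem E Big) (x y : V) :
    angleCount Big x y ≤ angleDist Big x y := by
  unfold angleDist
  split_ifs with hxy
  · simp [hxy, h.angleCount_self]
  · omega

theorem angleDist_le (Big : V → V → V → Prop) (x y : V) :
    angleDist Big x y ≤ angleCount Big x y + 1 := by
  unfold angleDist
  split_ifs <;> omega

theorem exists_angleDist_eq_one (h : BranchSystem E Big) {x y : V} {k : ℕ}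
    (hxy : angleDist Big x y = k + 1) : ∃ z, angleDist Big x z ≤ 1 ∧ angleDist Big z y ≤ k := by
  rcases Nat.eq_zero_or_pos (angleCount Big x y) with h0 | h0
  · refine ⟨y, ?_, ?_⟩
    · have := angleDist_le Big x y
      omega
    · simp [angleDist_eq_zero.2 rfl]
  · obtain ⟨v, h1, h2⟩ := h.exists_angleCount_eq_zero h0
    refine ⟨v, ?_, ?_⟩
    · have := angleDist_le Big x v
      omega
    · have := angleDist_le Big v y
      have := angleDist_le Big x y
      unfold angleDist at hxy
      split_ifs at hxy
      omega

/-- The combinatorial distance satisfies the four-point condition. -/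
theorem angleDist_hyperbolic (h : BranchSystem E Big) (x y z w : V) :
    min ((angleDist Big x w + angleDist Big y w - angleDist Big x y : ℝ) / 2)
      ((angleDist Big y w + angleDist Big z w - angleDist Big y z : ℝ) / 2) - 4 ≤
    (angleDist Big x w + angleDist Big z w - angleDist Big x z : ℝ) / 2 := by
  have key : ∀ a b : V,
      |(angleDist Big a w + angleDist Big b w - angleDist Big a b : ℝ) / 2 -
        commonCount E Big w a b| ≤ 2 := by
    intro a b
    obtain ⟨ε₁, h₁, e₁⟩ := h.exists_angleCount_eq a b w
    obtain ⟨ε₂, h₂, e₂⟩ := h.exists_angleCount_eq b a w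
    obtain ⟨ε₃, h₃, e₃⟩ := h.exists_angleCount_eq a w b
    have c₁ := h.commonCount_comm a b w
    have c₂ := h.commonCount_comm b a w
    have c₃ := h.commonCount_comm w a b
    have l₁ := h.angleCount_le_angleDist a w
    have l₂ := h.angleCount_le_angleDist b w
    have l₃ := h.angleCount_le_angleDist a b
    have u₁ := angleDist_le Big a w
    have u₂ := angleDist_le Big b w
    have u₃ := angleDist_le Big a b
    have t₁ : angleDist Big a w + angleDist Big b w ≤
      angleDist Big a b + 2 * commonCount E Big w a b + 4 := by omega
    have t₂ : angleDist Big a b + 2 * commonCount E Big w a b ≤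
      angleDist Big a w + angleDist Big b w + 4 := by omega
    have t₁' : (angleDist Big a w + angleDist Big b w : ℝ) ≤
      angleDist Big a b + 2 * commonCount E Big w a b + 4 := by exact_mod_cast t₁
    have t₂' : (angleDist Big a b + 2 * commonCount E Big w a b : ℝ) ≤
      angleDist Big a w + angleDist Big b w + 4 := by exact_mod_cast t₂
    rw [abs_le]
    constructor <;> linarith
  have hm : min (commonCount E Big w x y : ℝ) (commonCount E Big w y z) ≤ commonCount E Big w x z :=
    mod_cast h.min_commonCount_le w x y z
  have k₁ := abs_le.1 (key x y)
  have k₂ := abs_le.1 (key y z)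
  have k₃ := abs_le.1 (key x z)
  rcases min_le_iff.1 hm with hm | hm
  · exact (sub_le_sub_right (min_le_left _ _) _).trans (by linarith)
  · exact (sub_le_sub_right (min_le_right _ _) _).trans (by linarith)

end BranchSystem

namespace BranchSystem

variable {V : Type*} {E Big : V → V → V → Prop} {G : Type*} [Group G] [MulAction G V]

theorem angleCount_smul (hBig : ∀ (g : G) (v x y : V), Big v x y → Big (g • v) (g • x) (g • y))
    (g : G) (x y : V) : angleCount Big (g • x) (g • y) = angleCount Big x y := by
  have : {v | Big v (g • x) (g • y)} = (fun v => g • v) '' {v | Big v x y} := by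
    ext v
    simp only [Set.mem_ofPred_eq, Set.mem_image]
    constructor
    · intro hv
      exact ⟨g⁻¹ • v, by simpa using hBig g⁻¹ _ _ _ hv, smul_inv_smul g v⟩
    · rintro ⟨u, hu, rfl⟩
      exact hBig g _ _ _ hu
  rw [angleCount, this, Set.ncard_image_of_injective _ (MulAction.injective g), angleCount]

theorem angleDist_smul (hBig : ∀ (g : G) (v x y : V), Big v x y → Big (g • v) (g • x) (g • y))
    (g : G) (x y : V) : angleDist Big (g • x) (g • y) = angleDist Big x y := by
  by_cases hxy : x = y
  · simp [angleDist, hxy]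
  · have hg : g • x ≠ g • y := fun e => hxy (MulAction.injective g e)
    simp [angleDist, hxy, hg, angleCount_smul hBig]

/-- All but boundedly many angles on `[x', y']` see `x` and `x'` in the same branch. -/
theorem ncard_big_not_le (h : BranchSystem E Big) (x x' y' : V) :
    {w | Big w x' y' ∧ ¬ E w x x'}.ncard ≤ angleDist Big x x' + 1 := by
  have hsub : {w | Big w x' y' ∧ ¬ E w x x'} ⊆
      {w | Big w x x'} ∪ {w | Big w x' y' ∧ ¬ E w x' x ∧ ¬ E w y' x} := by
    rintro w ⟨hw, hx⟩
    by_cases hy : E w y' x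
    · exact Or.inl (h.big_symm (h.big_congr_right hy hw))
    · exact Or.inr ⟨hw, fun hx' => hx (h.symm hx'), hy⟩
  refine (Set.ncard_le_ncard hsub ((h.finite_big _ _).union (h.finite_big_and _ _ _))).trans
    ((Set.ncard_union_le _ _).trans (add_le_add (h.angleCount_le_angleDist x x') ?_))
  exact (Set.ncard_le_one (h.finite_big_and _ _ _)).2 fun a ha b hb =>
    h.subsingleton_big_of_not _ _ _ ha hb

/-- A group acting on a branch system so that distinguished angles have trivial stabilisers acts
acylindrically for the combinatorial distance. -/
theorem exists_acylindricity_constants (h : BranchSystem E Big)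
    (hE : ∀ (g : G) (v x y : V), E v x y → E (g • v) (g • x) (g • y))
    (hBig : ∀ (g : G) (v x y : V), Big v x y → Big (g • v) (g • x) (g • y))
    (hstab : ∀ (g : G) (v x y : V), Big v x y → g • v = v → E v (g • x) x → E v (g • y) y → g = 1)
    (R : ℕ) : ∃ L N : ℕ, ∀ x y : V, L ≤ angleDist Big x y →
      {g : G | angleDist Big x (g • x) ≤ R ∧ angleDist Big y (g • y) ≤ R}.Finite ∧
      {g : G | angleDist Big x (g • x) ≤ R ∧ angleDist Big y (g • y) ≤ R}.ncard ≤ N := by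
  refine ⟨2 * R + 4, (2 * R + 3) * (2 * R + 3), fun x y hxy => ?_⟩
  have hcard : 2 * R + 3 ≤ {v | Big v x y}.ncard := by
    have := angleDist_le Big x y
    unfold angleCount at this
    omega
  obtain ⟨F, hF, hFcard⟩ := Set.exists_subset_card_eq hcard
  have hFfin : F.Finite := (h.finite_big x y).subset hF
  set S := {g : G | angleDist Big x (g • x) ≤ R ∧ angleDist Big y (g • y) ≤ R} with hS
  have hgood : ∀ g ∈ S, ∃ v ∈ F, E (g • v) x (g • x) ∧ E (g • v) y (g • y) := by
    rintro g ⟨hx, hy⟩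
    by_contra! hcon
    have hsub : (fun v => g • v) '' F ⊆ {w | Big w (g • x) (g • y) ∧ ¬ E w x (g • x)} ∪
        {w | Big w (g • y) (g • x) ∧ ¬ E w y (g • y)} := by
      rintro _ ⟨v, hv, rfl⟩
      have hb := hBig g _ _ _ (hF hv)
      by_cases hvx : E (g • v) x (g • x)
      · exact Or.inr ⟨h.big_symm hb, hcon v hv hvx⟩
      · exact Or.inl ⟨hb, hvx⟩
    have h1 := Set.ncard_le_ncard hsub ((h.finite_big_and _ _ _).union (h.finite_big_and _ _ _))
    rw [Set.ncard_image_of_injective _ (MulAction.injective g), hFcard] at h1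
    have h2 := Set.ncard_union_le {w | Big w (g • x) (g • y) ∧ ¬ E w x (g • x)}
      {w | Big w (g • y) (g • x) ∧ ¬ E w y (g • y)}
    have h3 := h.ncard_big_not_le x (g • x) (g • y)
    have h4 := h.ncard_big_not_le y (g • y) (g • x)
    omega
  have : Nonempty V := ⟨x⟩
  choose! f hfF hfx hfy using hgood
  have hbound : ∀ g ∈ S, angleCount Big x (g • f g) ≤ angleCount Big x (f g) + (R + 1) ∧
      angleCount Big x (f g) ≤ angleCount Big x (g • f g) + (R + 1) := by
    intro g hg
    have h1 := h.angleCount_triangle x (g • x) (g • f g)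
    have h2 := h.angleCount_triangle (g • x) x (g • f g)
    rw [angleCount_smul hBig] at h1 h2
    rw [h.angleCount_comm (g • x) x] at h2
    have h3 := (h.angleCount_le_angleDist x (g • x)).trans hg.1
    omega
  let Ψ : G → V × ℕ := fun g =>
    (f g, angleCount Big x (g • f g) + (R + 1) - angleCount Big x (f g))
  have hmaps : ∀ g ∈ S, Ψ g ∈ F ×ˢ (Set.Iio (2 * R + 3)) := by
    intro g hg
    have := hbound g hg
    refine ⟨hfF g hg, ?_⟩
    simp only [Ψ, Set.mem_Iio]
    omega
  have hinj : Set.InjOn Ψ S := by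
    intro g hg k hk hgk
    obtain ⟨h1, h2⟩ := Prod.ext_iff.1 hgk
    simp only [Ψ] at h1 h2
    have hbg := hbound g hg
    have hbk := hbound k hk
    have hgx := hfx g hg
    have hgy := hfy g hg
    have hkx := hfx k hk
    have hky := hfy k hk
    have hvF := hF (hfF g hg)
    rw [← h1] at h2 hbk hkx hky
    set v := f g
    have hb := hBig g _ _ _ hvF
    have hb' := hBig k _ _ _ hvF
    have hv : g • v = k • v := h.angleCount_injOn x y
      (h.big_congr_right (h.symm hgy) (h.big_congr (h.symm hgx) hb))
      (h.big_congr_right (h.symm hky) (h.big_congr (h.symm hkx) hb')) (by omega)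
    rw [← hv] at hkx hky
    have e1 := hE g⁻¹ _ _ _ (h.trans (h.symm hkx) hgx)
    have e2 := hE g⁻¹ _ _ _ (h.trans (h.symm hky) hgy)
    rw [inv_smul_smul, inv_smul_smul, smul_smul] at e1 e2
    exact inv_mul_eq_one.1 (hstab (g⁻¹ * k) v x y hvF
      (by rw [mul_smul, ← hv, inv_smul_smul]) e1 e2)
  have hfin : (F ×ˢ (Set.Iio (2 * R + 3))).Finite := hFfin.prod (Set.finite_Iio _)
  refine ⟨Set.Finite.of_injOn hmaps hinj hfin, ?_⟩
  refine (Set.ncard_le_ncard_of_injOn Ψ hmaps hinj hfin).trans ?_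
  rw [Set.ncard_prod, hFcard]
  simp

end BranchSystem

/-- An integer-valued metric that is the path metric of a graph. -/
class GraphDist (V : Type*) where ofDist ::
  d : V → V → ℕ
  eq_zero : ∀ {x y}, d x y = 0 ↔ x = y
  comm : ∀ x y, d x y = d y x
  triangle : ∀ x y z, d x z ≤ d x y + d y z
  interpolate : ∀ {x y k}, d x y = k + 1 → ∃ z, d x z ≤ 1 ∧ d z y ≤ k

namespace GraphDist

/-- A point on an edge of the graph underlying a `GraphDist`. -/
@[ext]
structure EdgePoint (V : Type*) [GraphDist V] where ofCoord ::
  u : V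
  v : V
  t : ℝ
  adj : d u v ≤ 1
  nonneg : 0 ≤ t
  le : t ≤ d u v

variable {V : Type*} [GraphDist V]

theorem triangle_cast (x y z : V) : (d x z : ℝ) ≤ d x y + d y z := mod_cast triangle x y z

theorem d_self (x : V) : d x x = 0 := eq_zero.2 rfl

namespace EdgePoint

/-- The distance from a point on an edge to a vertex. -/
noncomputable def height (p : EdgePoint V) (a : V) : ℝ :=
  min (p.t + d p.u a) (d p.u p.v - p.t + d p.v a)

theorem height_le_add (p : EdgePoint V) (a b : V) : p.height a ≤ p.height b + d b a := by
  have h1 := triangle_cast p.u b a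
  have h2 := triangle_cast p.v b a
  unfold height
  rcases min_cases (p.t + d p.u b) (d p.u p.v - p.t + d p.v b) with h | h
  · exact (min_le_left _ _).trans (by linarith)
  · exact (min_le_right _ _).trans (by linarith)

theorem d_le_height_add (p : EdgePoint V) (a b : V) : d a b ≤ p.height a + p.height b := by
  have h1 := triangle_cast a p.u b
  have h2 := triangle_cast a p.v b
  have h3 := triangle_cast a p.u p.v
  have h3' := triangle_cast a p.v p.u
  have h4 := triangle_cast p.u p.v b
  have h4' := triangle_cast p.v p.u b
  rw [comm a p.u] at h1 h3
  rw [comm a p.v] at h2 h3'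
  rw [comm p.v p.u] at h3' h4'
  have := p.nonneg
  have := p.le
  unfold height
  rcases min_cases (p.t + d p.u a) (d p.u p.v - p.t + d p.v a) with h | h <;>
    rcases min_cases (p.t + d p.u b) (d p.u p.v - p.t + d p.v b) with h' | h' <;> linarith

theorem height_left (p : EdgePoint V) : p.height p.u = p.t := by
  have := p.le
  rw [height, d_self, comm p.v p.u, min_eq_left] <;> push_cast <;> linarith

theorem height_right (p : EdgePoint V) : p.height p.v = d p.u p.v - p.t := by
  have := p.nonneg
  rw [height, d_self, min_eq_right] <;> push_cast <;> linarith

/-- Two points lie on the same oriented edge. -/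
def SameEdge (p q : EdgePoint V) : Prop := p.u = q.u ∧ p.v = q.v

theorem SameEdge.height_le {p q : EdgePoint V} (h : SameEdge p q) (a : V) :
    p.height a ≤ |p.t - q.t| + q.height a := by
  unfold height
  rw [h.1, h.2]
  have h1 := abs_le.1 (le_refl |p.t - q.t|)
  rcases min_cases (q.t + d q.u a) (d q.u q.v - q.t + d q.v a) with h | h
  · exact (min_le_left _ _).trans (by linarith)
  · exact (min_le_right _ _).trans (by linarith)

theorem SameEdge.abs_le {p q : EdgePoint V} (h : SameEdge p q) (a : V) :
    |p.t - q.t| ≤ p.height a + q.height a := by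
  have h1 := p.nonneg
  have h2 := p.le
  have h3 := q.nonneg
  have h4 := q.le
  have h5 : (0 : ℝ) ≤ d q.u a := by positivity
  have h6 : (0 : ℝ) ≤ d q.v a := by positivity
  have h7 := triangle_cast q.u a q.v
  rw [comm a q.v] at h7
  unfold height
  rw [h.1, h.2] at *
  rcases min_cases (p.t + d q.u a) (d q.u q.v - p.t + d q.v a) with h | h <;>
    rcases min_cases (q.t + d q.u a) (d q.u q.v - q.t + d q.v a) with h' | h' <;>
    exact _root_.abs_le.2 ⟨by linarith, by linarith⟩

/-- The path metric on the union of the edges. -/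
noncomputable def edgeDist (p q : EdgePoint V) : ℝ :=
  open Classical in
  if SameEdge p q then |p.t - q.t|
  else min (p.height q.u + q.height q.u) (p.height q.v + q.height q.v)

theorem edgeDist_le (p q : EdgePoint V) (a : V) : edgeDist p q ≤ p.height a + q.height a := by
  unfold edgeDist
  split_ifs with h
  · exact h.abs_le a
  · have h1 := p.height_le_add q.u a
    have h2 := p.height_le_add q.v a
    rw [comm] at h1 h2
    have h3 : q.height a = min (q.t + d q.u a) (d q.u q.v - q.t + d q.v a) := rfl
    rw [height_left, height_right, h3]
    rcases min_cases (q.t + d q.u a) (d q.u q.v - q.t + d q.v a) with h | h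
    · exact (min_le_left _ _).trans (by linarith)
    · exact (min_le_right _ _).trans (by linarith)

theorem exists_edgeDist_eq {p q : EdgePoint V} (h : ¬ SameEdge p q) :
    ∃ a, edgeDist p q = p.height a + q.height a := by
  unfold edgeDist
  rw [if_neg h]
  rcases min_choice (p.height q.u + q.height q.u) (p.height q.v + q.height q.v) with h | h
  · exact ⟨q.u, h⟩
  · exact ⟨q.v, h⟩

theorem edgeDist_of_sameEdge {p q : EdgePoint V} (h : SameEdge p q) :
    edgeDist p q = |p.t - q.t| := if_pos h

theorem sameEdge_comm {p q : EdgePoint V} : SameEdge p q ↔ SameEdge q p :=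
  ⟨fun h => ⟨h.1.symm, h.2.symm⟩, fun h => ⟨h.1.symm, h.2.symm⟩⟩

theorem edgeDist_comm (p q : EdgePoint V) : edgeDist p q = edgeDist q p := by
  by_cases h : SameEdge p q
  · rw [edgeDist_of_sameEdge h, edgeDist_of_sameEdge (sameEdge_comm.1 h), abs_sub_comm]
  · obtain ⟨a, ha⟩ := exists_edgeDist_eq h
    obtain ⟨b, hb⟩ := exists_edgeDist_eq (mt sameEdge_comm.1 h)
    have h1 := edgeDist_le q p a
    have h2 := edgeDist_le p q b
    linarith

theorem edgeDist_triangle (p q r : EdgePoint V) : edgeDist p r ≤ edgeDist p q + edgeDist q r := by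
  by_cases h : SameEdge p q <;> by_cases h' : SameEdge q r
  · rw [edgeDist_of_sameEdge h, edgeDist_of_sameEdge h',
      edgeDist_of_sameEdge ⟨h.1.trans h'.1, h.2.trans h'.2⟩]
    exact abs_sub_le _ _ _
  · obtain ⟨a, ha⟩ := exists_edgeDist_eq h'
    rw [edgeDist_of_sameEdge h, ha]
    have h1 := edgeDist_le p r a
    have h2 := h.height_le a
    linarith
  · obtain ⟨a, ha⟩ := exists_edgeDist_eq h
    rw [edgeDist_of_sameEdge h', ha]
    have h1 := edgeDist_le p r a
    have h2 := (sameEdge_comm.1 h').height_le a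
    rw [abs_sub_comm] at h2
    linarith
  · obtain ⟨a, ha⟩ := exists_edgeDist_eq h
    obtain ⟨b, hb⟩ := exists_edgeDist_eq h'
    have h1 := edgeDist_le p r a
    have h2 := r.height_le_add a b
    have h3 := q.d_le_height_add b a
    linarith

noncomputable instance : PseudoMetricSpace (EdgePoint V) where
  dist := edgeDist
  dist_self p := by
    rw [edgeDist_of_sameEdge ⟨rfl, rfl⟩, sub_self, abs_zero]
  dist_comm := edgeDist_comm
  dist_triangle := edgeDist_triangle

theorem dist_eq (p q : EdgePoint V) : dist p q = edgeDist p q := rfl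

/-- A vertex, as a point on a degenerate edge. -/
def ofVertex (a : V) : EdgePoint V := ⟨a, a, 0, by simp [d_self], le_rfl, by simp⟩

theorem height_ofVertex (a b : V) : (ofVertex a).height b = d a b := by
  simp [height, ofVertex, d_self]

theorem dist_ofVertex (p : EdgePoint V) (a : V) : dist p (ofVertex a) = p.height a := by
  rw [dist_eq]
  by_cases h : SameEdge p (ofVertex a)
  · obtain ⟨h1, h2⟩ := h
    have h3 := p.le
    have h4 := p.nonneg
    have h1' : p.u = a := h1
    have h2' : p.v = a := h2
    have h5 : p.t = 0 := by
      rw [h1', h2', d_self] at h3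
      exact le_antisymm (by simpa using h3) h4
    rw [edgeDist_of_sameEdge ⟨h1, h2⟩, height, h1', h2', h5]
    simp [ofVertex, d_self]
  · unfold edgeDist
    rw [if_neg h]
    change min (p.height a + (ofVertex a).height a) (p.height a + (ofVertex a).height a) = _
    rw [height_ofVertex, d_self]
    simp

theorem dist_ofVertex_left (p : EdgePoint V) : dist p (ofVertex p.u) ≤ 1 := by
  rw [dist_ofVertex, height_left]
  exact p.le.trans (mod_cast p.adj)

theorem dist_vertices (a b : V) : dist (ofVertex a) (ofVertex b) = d a b := by
  rw [dist_ofVertex, height_ofVertex]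

theorem abs_dist_sub_le (p q : EdgePoint V) : |dist p q - d p.u q.u| ≤ 2 := by
  have h1 := p.dist_ofVertex_left
  have h2 := q.dist_ofVertex_left
  have h3 := dist_triangle4 p (ofVertex p.u) (ofVertex q.u) q
  have h4 := dist_triangle4 (ofVertex p.u) p q (ofVertex q.u)
  rw [dist_comm (ofVertex q.u) q] at h3
  rw [dist_comm (ofVertex p.u) p] at h4
  rw [dist_vertices] at h3 h4
  exact abs_le.2 ⟨by linarith, by linarith⟩

end EdgePoint

/-- Two points are joined by a geodesic. -/
def Joined {X : Type*} [MetricSpace X] (x y : X) : Prop :=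
  ∃ γ : ℝ → X, γ 0 = x ∧ γ (dist x y) = y ∧ ∀ s ∈ Set.Icc (0 : ℝ) (dist x y),
    ∀ t ∈ Set.Icc (0 : ℝ) (dist x y), dist (γ s) (γ t) = |s - t|

namespace Joined

variable {X : Type*} [MetricSpace X]

theorem refl (x : X) : Joined x x := by
  refine ⟨fun _ => x, rfl, rfl, ?_⟩
  simp

theorem symm {x y : X} (h : Joined x y) : Joined y x := by
  obtain ⟨γ, h0, h1, hγ⟩ := h
  refine ⟨fun s => γ (dist x y - s), by simpa using h1, by simpa [dist_comm y x] using h0, ?_⟩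
  rw [dist_comm y x]
  intro s hs t ht
  rw [hγ _ ⟨by linarith [hs.2], by linarith [hs.1]⟩ _ ⟨by linarith [ht.2], by linarith [ht.1]⟩,
    abs_sub_comm]
  congr 1
  ring

theorem trans {x y z : X} (h : Joined x y) (h' : Joined y z)
    (hd : dist x z = dist x y + dist y z) : Joined x z := by
  obtain ⟨γ, h0, h1, hγ⟩ := h
  obtain ⟨η, k0, k1, hη⟩ := h'
  have hxy := dist_nonneg (x := x) (y := y)
  have hyz := dist_nonneg (x := y) (y := z)
  have hmix : ∀ s ∈ Set.Icc 0 (dist x y), ∀ t ∈ Set.Icc (dist x y) (dist x z),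
      dist (γ s) (η (t - dist x y)) = |s - t| := by
    intro s hs t ht
    have e1 := hγ s hs 0 ⟨le_rfl, hxy⟩
    have e2 := hγ s hs _ ⟨hxy, le_rfl⟩
    have e3 := hη (t - dist x y) ⟨by linarith [ht.1], by linarith [ht.2]⟩ 0 ⟨le_rfl, hyz⟩
    have e4 := hη (t - dist x y) ⟨by linarith [ht.1], by linarith [ht.2]⟩ _ ⟨hyz, le_rfl⟩
    rw [h0, sub_zero, abs_of_nonneg hs.1] at e1
    rw [h1, abs_of_nonpos (by linarith [hs.2])] at e2
    rw [k0, sub_zero, abs_of_nonneg (by linarith [ht.1])] at e3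
    rw [k1, abs_of_nonpos (by linarith [ht.2])] at e4
    have t1 := dist_triangle (γ s) y (η (t - dist x y))
    have t2 := dist_triangle4 x (γ s) (η (t - dist x y)) z
    rw [dist_comm y] at t1
    rw [dist_comm x (γ s)] at t2
    rw [abs_of_nonpos (by linarith [hs.2, ht.1])]
    linarith
  refine ⟨fun s => if s ≤ dist x y then γ s else η (s - dist x y), by simp [hxy, h0], ?_, ?_⟩
  · dsimp only
    split_ifs with hle
    · have hyz' : dist y z = 0 := le_antisymm (by linarith) hyz
      rw [hd, hyz', add_zero, h1]
      exact dist_eq_zero.1 hyz'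
    · rw [hd, add_sub_cancel_left, k1]
  · intro s hs t ht
    dsimp only
    split_ifs with h1 h2 h2
    · exact hγ s ⟨hs.1, h1⟩ t ⟨ht.1, h2⟩
    · exact hmix s ⟨hs.1, h1⟩ t ⟨(not_le.1 h2).le, ht.2⟩
    · rw [dist_comm, abs_sub_comm]
      exact hmix t ⟨ht.1, h2⟩ s ⟨(not_le.1 h1).le, hs.2⟩
    · rw [hη _ ⟨by linarith, by linarith [hs.2]⟩ _ ⟨by linarith, by linarith [ht.2]⟩]
      congr 1
      ring

end Joined

open SeparationQuotient EdgePoint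

theorem joined_of_sameEdge {p q : EdgePoint V} (h : SameEdge p q) : Joined (mk p) (mk q) := by
  wlog hpq : p.t ≤ q.t
  · exact (this (sameEdge_comm.1 h) (not_le.1 hpq).le).symm
  have hd : dist (mk p) (mk q) = q.t - p.t := by
    rw [dist_mk, EdgePoint.dist_eq, edgeDist_of_sameEdge h, abs_sub_comm,
      abs_of_nonneg (sub_nonneg.2 hpq)]
  have hmem : ∀ s : ℝ, 0 ≤ min (p.t + max s 0) q.t ∧ min (p.t + max s 0) q.t ≤ d p.u p.v := by
    intro s
    have := p.nonneg
    have := q.le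
    have := le_max_right s 0
    exact ⟨le_min (by linarith) (by linarith), (min_le_right _ _).trans (by rwa [h.1, h.2])⟩
  refine ⟨fun s => mk ⟨p.u, p.v, _, p.adj, (hmem s).1, (hmem s).2⟩, ?_, ?_, ?_⟩
  · exact congrArg mk (EdgePoint.ext rfl rfl (by simp [hpq]))
  · rw [hd]
    exact congrArg mk (EdgePoint.ext h.1 h.2 (by simp [hpq]))
  · rw [hd]
    rintro s ⟨hs0, hs1⟩ t ⟨ht0, ht1⟩
    rw [dist_mk, EdgePoint.dist_eq, edgeDist,
      if_pos (by exact ⟨rfl, rfl⟩)]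
    dsimp only
    rw [max_eq_left hs0, max_eq_left ht0, min_eq_left (by linarith), min_eq_left (by linarith)]
    congr 1
    ring

theorem joined_left (p : EdgePoint V) : Joined (mk p) (mk (ofVertex p.u)) := by
  have : mk (ofVertex p.u) = mk (⟨p.u, p.v, 0, p.adj, le_rfl, by simp⟩ : EdgePoint V) := by
    rw [← dist_eq_zero, dist_mk, dist_comm, dist_ofVertex]
    exact height_left (⟨p.u, p.v, 0, p.adj, le_rfl, by simp⟩ : EdgePoint V)
  rw [this]
  exact joined_of_sameEdge ⟨rfl, rfl⟩

theorem joined_right (p : EdgePoint V) : Joined (mk p) (mk (ofVertex p.v)) := by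
  have : mk (ofVertex p.v) =
      mk (⟨p.u, p.v, d p.u p.v, p.adj, by simp, le_rfl⟩ : EdgePoint V) := by
    rw [← dist_eq_zero, dist_mk, dist_comm, dist_ofVertex]
    exact (height_right (⟨p.u, p.v, d p.u p.v, p.adj, by simp, le_rfl⟩ : EdgePoint V)).trans
      (sub_self _)
  rw [this]
  exact joined_of_sameEdge ⟨rfl, rfl⟩

theorem joined_vertices (a b : V) : Joined (mk (ofVertex a)) (mk (ofVertex b)) := by
  induction hk : d a b generalizing a with
  | zero => rw [eq_zero.1 hk]; exact Joined.refl _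
  | succ k ih =>
    obtain ⟨z, h1, h2⟩ := interpolate hk
    have h3 := triangle a z b
    have h4 : d z b = k := by omega
    refine Joined.trans (y := mk (ofVertex z)) ?_ (ih z h4) ?_
    · exact (joined_left ⟨a, z, 0, h1, le_rfl, by simp⟩).symm.trans
        (joined_right ⟨a, z, 0, h1, le_rfl, by simp⟩) (by
          rw [dist_mk, dist_mk, dist_mk, dist_vertices, dist_comm (ofVertex _), dist_ofVertex,
            dist_ofVertex, height_left, height_right]
          simp)
    · simp only [dist_mk, dist_vertices]
      norm_cast
      omega

theorem joined_vertex (p : EdgePoint V) (a : V) : Joined (mk p) (mk (ofVertex a)) := by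
  have h : dist (mk p) (mk (ofVertex a)) = p.height a := by rw [dist_mk, dist_ofVertex]
  rcases min_choice (p.t + d p.u a) (d p.u p.v - p.t + d p.v a) with hm | hm
  · refine (joined_left p).trans (joined_vertices _ _) ?_
    rw [h, dist_mk, dist_mk, dist_vertices, dist_ofVertex, height_left]
    exact hm
  · refine (joined_right p).trans (joined_vertices _ _) ?_
    rw [h, dist_mk, dist_mk, dist_vertices, dist_ofVertex, height_right]
    exact hm

theorem isGeodesicSpace : IsGeodesicSpace (SeparationQuotient (EdgePoint V)) := by
  intro x y
  change Joined x y
  obtain ⟨p, rfl⟩ := surjective_mk x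
  obtain ⟨q, rfl⟩ := surjective_mk y
  by_cases h : SameEdge p q
  · exact joined_of_sameEdge h
  · obtain ⟨a, ha⟩ := exists_edgeDist_eq h
    refine (joined_vertex p a).trans (joined_vertex q a).symm ?_
    rw [dist_comm (mk (ofVertex a)), dist_mk, dist_mk, dist_mk, dist_ofVertex, dist_ofVertex]
    exact ha

theorem isGromovHyperbolic {δ : ℝ} (hδ : 0 ≤ δ) (h : ∀ x y z w : V,
    min ((d x w + d y w - d x y : ℝ) / 2) ((d y w + d z w - d y z : ℝ) / 2) - δ ≤
      (d x w + d z w - d x z : ℝ) / 2) :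
    IsGromovHyperbolic (SeparationQuotient (EdgePoint V)) := by
  refine ⟨δ + 6, by linarith, fun x y z w => ?_⟩
  obtain ⟨p, rfl⟩ := surjective_mk x
  obtain ⟨q, rfl⟩ := surjective_mk y
  obtain ⟨r, rfl⟩ := surjective_mk z
  obtain ⟨s, rfl⟩ := surjective_mk w
  simp only [dist_mk]
  have h0 := h p.u q.u r.u s.u
  have h1 := abs_le.1 (abs_dist_sub_le p s)
  have h2 := abs_le.1 (abs_dist_sub_le q s)
  have h3 := abs_le.1 (abs_dist_sub_le r s)
  have h4 := abs_le.1 (abs_dist_sub_le p q)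
  have h5 := abs_le.1 (abs_dist_sub_le q r)
  have h6 := abs_le.1 (abs_dist_sub_le p r)
  rw [ge_iff_le, sub_le_iff_le_add, min_le_iff]
  rw [sub_le_iff_le_add, min_le_iff] at h0
  exact h0.imp (fun h0 => by linarith) (fun h0 => by linarith)

section Action

variable {G : Type*} [Group G] [MulAction G V]

/-- A group acts on a graph by isometries. -/
class IsometricAction (G V : Type*) [Group G] [MulAction G V] [GraphDist V] : Prop where
  d_smul : ∀ (g : G) (x y : V), d (g • x) (g • y) = d x y

variable [IsometricAction G V]

open IsometricAction

instance : MulAction G (EdgePoint V) where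
  smul g p := ⟨g • p.u, g • p.v, p.t, (d_smul g _ _).trans_le p.adj, p.nonneg,
    by rw [d_smul]; exact p.le⟩
  one_smul p := EdgePoint.ext (one_smul G p.u) (one_smul G p.v) rfl
  mul_smul g k p := EdgePoint.ext (mul_smul g k p.u) (mul_smul g k p.v) rfl

theorem height_smul (g : G) (p : EdgePoint V) (a : V) : (g • p).height (g • a) = p.height a := by
  change min (p.t + d (g • p.u) (g • a)) (d (g • p.u) (g • p.v) - p.t + d (g • p.v) (g • a)) = _
  simp only [d_smul]
  rfl

instance : IsIsometricSMul G (EdgePoint V) where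
  isometry_smul g := by
    refine Isometry.of_dist_eq fun p q => ?_
    have hs : SameEdge (g • p) (g • q) ↔ SameEdge p q :=
      and_congr (MulAction.injective g).eq_iff (MulAction.injective g).eq_iff
    rw [EdgePoint.dist_eq, EdgePoint.dist_eq]
    by_cases h : SameEdge p q
    · rw [edgeDist_of_sameEdge h, edgeDist_of_sameEdge (hs.2 h)]
      rfl
    · unfold edgeDist
      rw [if_neg h, if_neg (mt hs.1 h), ← height_smul g p, ← height_smul g p, ← height_smul g q,
        ← height_smul g q]
      rfl

theorem isAcylindricalAction (h : ∀ R : ℕ, ∃ L N : ℕ, ∀ x y : V, L ≤ d x y →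
      {g : G | d x (g • x) ≤ R ∧ d y (g • y) ≤ R}.Finite ∧
      {g : G | d x (g • x) ≤ R ∧ d y (g • y) ≤ R}.ncard ≤ N) :
    IsAcylindricalAction fun (g : G) (x : SeparationQuotient (EdgePoint V)) => g • x := by
  intro r hr
  obtain ⟨L, N, hLN⟩ := h (⌈r⌉₊ + 2)
  refine ⟨L + 2, N, by positivity, fun x y hxy => ?_⟩
  obtain ⟨p, rfl⟩ := surjective_mk x
  obtain ⟨q, rfl⟩ := surjective_mk y
  rw [dist_mk] at hxy
  have hpq := abs_le.1 (abs_dist_sub_le p q)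
  have hL : L ≤ d p.u q.u := by
    have : (L : ℝ) ≤ d p.u q.u := by linarith
    exact_mod_cast this
  obtain ⟨hfin, hcard⟩ := hLN _ _ hL
  have key : ∀ (g : G) (p : EdgePoint V), dist (mk p) (g • mk p) ≤ r →
      d p.u (g • p.u) ≤ ⌈r⌉₊ + 2 := by
    intro g p hg
    rw [← mk_smul, dist_mk] at hg
    have h1 := abs_le.1 (abs_dist_sub_le p (g • p))
    have h2 : (d p.u (g • p.u) : ℝ) ≤ ⌈r⌉₊ + 2 := by
      have := Nat.le_ceil r
      change _ ≤ dist p (g • p) - (d p.u (g • p.u) : ℝ) ∧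
        dist p (g • p) - (d p.u (g • p.u) : ℝ) ≤ _ at h1
      linarith
    exact_mod_cast h2
  have hsub : {g : G | dist (mk p) (g • mk p) ≤ r ∧ dist (mk q) (g • mk q) ≤ r} ⊆
      {g : G | d p.u (g • p.u) ≤ ⌈r⌉₊ + 2 ∧ d q.u (g • q.u) ≤ ⌈r⌉₊ + 2} :=
    fun g hg => ⟨key g p hg.1, key g q hg.2⟩
  exact ⟨hfin.subset hsub, (Set.ncard_le_ncard hsub hfin).trans hcard⟩

theorem goodAcylAction {δ : ℝ} (hδ : 0 ≤ δ) (hhyp : ∀ x y z w : V,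
      min ((d x w + d y w - d x y : ℝ) / 2) ((d y w + d z w - d y z : ℝ) / 2) - δ ≤
        (d x w + d z w - d x z : ℝ) / 2)
    (hacyl : ∀ R : ℕ, ∃ L N : ℕ, ∀ x y : V, L ≤ d x y →
      {g : G | d x (g • x) ≤ R ∧ d y (g • y) ≤ R}.Finite ∧
      {g : G | d x (g • x) ≤ R ∧ d y (g • y) ≤ R}.ncard ≤ N)
    {x₀ : V} (hunb : ∀ k : ℕ, ∃ g : G, k ≤ d x₀ (g • x₀)) :
    GoodAcylAction G (SeparationQuotient (EdgePoint V)) fun g x => g • x := by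
  have hdist : ∀ (g : G) (p q : EdgePoint V), dist (g • mk p) (g • mk q) = dist (mk p) (mk q) := by
    intro g p q
    rw [← mk_smul, ← mk_smul, dist_mk, dist_mk, dist_smul]
  refine ⟨fun g => Isometry.of_dist_eq fun x y => ?_, one_smul G, mul_smul, isGeodesicSpace,
    isGromovHyperbolic hδ hhyp, isAcylindricalAction hacyl, mk (ofVertex x₀), fun hb => ?_⟩
  · obtain ⟨p, rfl⟩ := surjective_mk x
    obtain ⟨q, rfl⟩ := surjective_mk y
    exact hdist g p q
  · obtain ⟨C, hC⟩ := Metric.isBounded_iff.1 hb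
    obtain ⟨g, hg⟩ := hunb (⌈C⌉₊ + 1)
    have h1 := hC ⟨1, rfl⟩ ⟨g, rfl⟩
    dsimp only at h1
    rw [one_smul, ← mk_smul, dist_mk] at h1
    have h2 : dist (ofVertex x₀) (g • ofVertex x₀) = d x₀ (g • x₀) := dist_vertices x₀ (g • x₀)
    rw [h2] at h1
    have h3 : ((⌈C⌉₊ + 1 : ℕ) : ℝ) ≤ d x₀ (g • x₀) := Nat.cast_le.2 hg
    push_cast at h3
    linarith [Nat.le_ceil C]

end Action

end GraphDist

namespace SyllableDecomposition

section General

variable {ι G : Type*} [Group G] {C : Subgroup G} {K : ι → Subgroup G} {P : ι → Set G}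

theorem base_mul_mem_iff (h : SyllableDecomposition C K P) {i : ι} {c g : G} (hc : c ∈ C) :
    c * g ∈ P i ↔ g ∈ P i :=
  ⟨fun hg => by simpa using h.base_mul_mem (inv_mem hc) hg, h.base_mul_mem hc⟩

theorem one_notMem (h : SyllableDecomposition C K P) (i : ι) : (1 : G) ∉ P i :=
  h.notMem_of_mem_base (one_mem C)

theorem mem_of_mem (h : SyllableDecomposition C K P) {i : ι} {x : G} (hx : x ∈ K i) (hxC : x ∉ C) :
    x ∈ P i := by
  simpa using h.mul_mem hx hxC (h.one_notMem i)

theorem eq_of_mem (h : SyllableDecomposition C K P) {i j : ι} {x : G} (hx : x ∈ K j)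
    (hxP : x ∈ P i) : i = j :=
  h.disjoint hxP (h.mem_of_mem hx fun hC => h.notMem_of_mem_base hC hxP)

theorem mul_mem_of_mem (h : SyllableDecomposition C K P) {i j : ι} {x r : G} (hx : x ∈ K i)
    (hxC : x ∉ C) (hr : r ∈ P j) (hij : i ≠ j) : x * r ∈ P i :=
  h.mul_mem hx hxC fun hr' => hij (h.disjoint hr' hr)

/-- Every element outside the base has a last syllable. -/
theorem exists_last (h : SyllableDecomposition C K P) {g : G} (hg : g ∉ C) :
    ∃ i j, g ∈ P i ∧ ∀ s ∉ P j, g * s ∈ P i := by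
  refine (h.induction (fun g => g ∈ C ∨ ∃ i j, g ∈ P i ∧ ∀ s ∉ P j, g * s ∈ P i)
    (fun c hc => Or.inl hc) (fun i x r hx hxC hr ih => Or.inr ?_) g).resolve_left hg
  rcases ih with hrC | ⟨k, j, hrk, hs⟩
  · refine ⟨i, i, h.mul_mem hx hxC hr, fun s hs => ?_⟩
    rw [mul_assoc]
    exact h.mul_mem hx hxC (mt (h.base_mul_mem_iff hrC).1 hs)
  · have hik : i ≠ k := by
      rintro rfl
      exact hr hrk
    refine ⟨i, j, h.mul_mem hx hxC hr, fun s hsj => ?_⟩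
    rw [mul_assoc]
    exact h.mul_mem_of_mem hx hxC (hs s hsj) hik

theorem mul_mem_or (h : SyllableDecomposition C K P) {i : ι} (k : ι) {g : G} (hg : g ∈ P i) :
    (∀ s ∈ P k, g * s ∈ P i) ∨ ∀ s ∉ P k, g * s ∈ P i := by
  obtain ⟨i', j, hi', hj⟩ := h.exists_last fun hC => h.notMem_of_mem_base hC hg
  obtain rfl := h.disjoint hg hi'
  by_cases hjk : j = k
  · exact Or.inr (hjk ▸ hj)
  · exact Or.inl fun s hs => hj s fun hs' => hjk (h.disjoint hs' hs)

theorem mul_mem_of_notMem (h : SyllableDecomposition C K P) {j : ι} {s : G} (hs : s ∈ K j) (g : G) :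
    g ∉ K j → ∀ k, g ∈ P k → g * s ∈ P k := by
  refine h.induction (fun g => g ∉ K j → ∀ k, g ∈ P k → g * s ∈ P k)
    (fun c hc hcj => absurd (h.base_le j hc) hcj) (fun i x r hx hxC hr ih hj k hk => ?_) g
  obtain rfl := h.disjoint (h.mul_mem hx hxC hr) hk
  rw [mul_assoc]
  refine h.mul_mem hx hxC fun hrs => ?_
  by_cases hrj : r ∈ K j
  · obtain rfl := h.eq_of_mem (MulMemClass.mul_mem hrj hs) hrs
    exact hj (MulMemClass.mul_mem hx hrj)
  · obtain ⟨l, _, hl, -⟩ := h.exists_last fun hC => hrj (h.base_le j hC)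
    obtain rfl := h.disjoint hrs (ih hrj l hl)
    exact hr hl

theorem mul_mem_iff_of_notMem (h : SyllableDecomposition C K P) {j k : ι} {s g : G} (hs : s ∈ K j)
    (hg : g ∉ K j) : g * s ∈ P k ↔ g ∈ P k := by
  refine ⟨fun hgs => ?_, h.mul_mem_of_notMem hs g hg k⟩
  simpa using h.mul_mem_of_notMem (inv_mem hs) (g * s)
    (fun hgs' => hg ((Subgroup.mul_mem_cancel_right _ hs).1 hgs')) k hgs

theorem mul_mem_iff (h : SyllableDecomposition C K P) {j k : ι} (hjk : j ≠ k) {s g : G}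
    (hs : s ∈ K j) : g * s ∈ P k ↔ g ∈ P k := by
  by_cases hg : g ∈ K j
  · exact ⟨fun h' => absurd (h.eq_of_mem (MulMemClass.mul_mem hg hs) h').symm hjk,
      fun h' => absurd (h.eq_of_mem hg h').symm hjk⟩
  · exact h.mul_mem_iff_of_notMem hs hg

end General

variable {G : Type*} [Group G] {C : Subgroup G} {K : Bool → Subgroup G} {P : Bool → Set G}

/-- The cosets of the first factor whose reduced form begins in the second factor. -/
def cone (K : Bool → Subgroup G) (P : Bool → Set G) : Set (G ⧸ K false) :=
  {x | ∃ z ∈ P true, (z : G ⧸ K false) = x}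

theorem mk_mem_cone (h : SyllableDecomposition C K P) {z : G} :
    (z : G ⧸ K false) ∈ cone K P ↔ z ∈ P true := by
  refine ⟨?_, fun hz => ⟨z, hz, rfl⟩⟩
  rintro ⟨w, hw, hwz⟩
  have := (h.mul_mem_iff (j := false) (k := true) (by simp) (g := w) (QuotientGroup.eq.1 hwz)).2 hw
  simpa using this

theorem smul_mem_cone_iff (h : SyllableDecomposition C K P) {c : G} (hc : c ∈ C)
    {x : G ⧸ K false} : c • x ∈ cone K P ↔ x ∈ cone K P := by
  obtain ⟨z, rfl⟩ := QuotientGroup.mk_surjective x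
  rw [MulAction.Quotient.smul_mk, smul_eq_mul, h.mk_mem_cone, h.mk_mem_cone, h.base_mul_mem_iff hc]

theorem mem_base_of_cone (h : SyllableDecomposition C K P) {u : G} (hu : u ∈ K false)
    {x : G ⧸ K false} (hx : x ∈ cone K P) (hux : u • x ∈ cone K P) : u ∈ C := by
  obtain ⟨z, rfl⟩ := QuotientGroup.mk_surjective x
  rw [MulAction.Quotient.smul_mk, smul_eq_mul, h.mk_mem_cone] at hux
  rw [h.mk_mem_cone] at hx
  by_contra huC
  exact Bool.false_ne_true (h.disjoint (h.mul_mem_of_mem hu huC hx (by simp)) hux)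

theorem exists_inv_smul_mem_cone (h : SyllableDecomposition C K P) {v x : G ⧸ K false}
    (hx : x ≠ v) : ∃ g : G, (g : G ⧸ K false) = v ∧ g⁻¹ • x ∈ cone K P := by
  obtain ⟨k, rfl⟩ := QuotientGroup.mk_surjective v
  obtain ⟨z, rfl⟩ := QuotientGroup.mk_surjective x
  have hkz : k⁻¹ * z ∉ K false := fun hk => hx (QuotientGroup.eq.2 hk).symm
  suffices ∀ g, g ∉ K false → ∃ u ∈ K false, u⁻¹ * g ∈ P true by
    obtain ⟨u, hu, huz⟩ := this _ hkz
    refine ⟨k * u, QuotientGroup.mk_mul_of_mem k hu, ?_⟩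
    rw [MulAction.Quotient.smul_mk, smul_eq_mul, h.mk_mem_cone]
    simpa [mul_assoc] using huz
  refine h.induction _ (fun c hc hcK => absurd (h.base_le _ hc) hcK) fun i y r hy hyC hr ih hyr => ?_
  cases i
  · have hrK : r ∉ K false := fun hrK => hyr (MulMemClass.mul_mem hy hrK)
    obtain ⟨u, hu, hur⟩ := ih hrK
    exact ⟨y * u, MulMemClass.mul_mem hy hu, by simpa [mul_assoc] using hur⟩
  · exact ⟨1, one_mem _, by simpa using h.mul_mem hy hyC hr⟩

theorem mk_one_notMem_cone (h : SyllableDecomposition C K P) {g : G} (hg : g ∈ K false) :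
    (g : G ⧸ K false) ∉ cone K P := fun hg' =>
  Bool.false_ne_true (h.eq_of_mem hg (h.mk_mem_cone.1 hg')).symm

/-- The vertices `x` and `y` of the Bass–Serre tree lie in the same branch at `v`. -/
def SameBranch (K : Bool → Subgroup G) (P : Bool → Set G) (v x y : G ⧸ K false) : Prop :=
  ∃ g : G, (g : G ⧸ K false) = v ∧ g⁻¹ • x ∈ cone K P ∧ g⁻¹ • y ∈ cone K P

/-- The branches of `x` and `y` at `v` form a translate of the angle between `1` and `a`. -/
def IsAngle (K : Bool → Subgroup G) (P : Bool → Set G) (a : G) (v x y : G ⧸ K false) : Prop :=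
  ∃ g : G, (g : G ⧸ K false) = v ∧
    (g⁻¹ • x ∈ cone K P ∧ (g * a)⁻¹ • y ∈ cone K P ∨
      g⁻¹ • y ∈ cone K P ∧ (g * a)⁻¹ • x ∈ cone K P)

theorem ne_of_inv_smul_mem_cone (h : SyllableDecomposition C K P) {g : G} {x : G ⧸ K false}
    (hx : g⁻¹ • x ∈ cone K P) : x ≠ g := by
  rintro rfl
  rw [MulAction.Quotient.smul_mk, smul_eq_mul, inv_mul_cancel] at hx
  exact h.mk_one_notMem_cone (one_mem _) hx

theorem inv_mul_mem_base (h : SyllableDecomposition C K P) {g k : G} {x : G ⧸ K false}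
    (hgk : (g : G ⧸ K false) = k) (hg : g⁻¹ • x ∈ cone K P) (hk : k⁻¹ • x ∈ cone K P) :
    g⁻¹ * k ∈ C :=
  h.mem_base_of_cone (QuotientGroup.eq.1 hgk) hk (by rwa [smul_smul, mul_inv_cancel_right])

theorem SameBranch.inv_smul_mem (h : SyllableDecomposition C K P) {g : G} {x y : G ⧸ K false}
    (hxy : SameBranch K P g x y) (hg : g⁻¹ • x ∈ cone K P) : g⁻¹ • y ∈ cone K P := by
  obtain ⟨k, hk, hx, hy⟩ := hxy
  have := (h.smul_mem_cone_iff (h.inv_mul_mem_base hk.symm hg hx)).2 hy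
  rwa [smul_smul, mul_inv_cancel_right] at this

theorem sameBranch_comm {v x y : G ⧸ K false} (hxy : SameBranch K P v x y) :
    SameBranch K P v y x :=
  let ⟨g, hg, hx, hy⟩ := hxy
  ⟨g, hg, hy, hx⟩

theorem sameBranch_trans (h : SyllableDecomposition C K P) {v x y z : G ⧸ K false}
    (hxy : SameBranch K P v x y) (hyz : SameBranch K P v y z) : SameBranch K P v x z := by
  obtain ⟨g, rfl, hx, hy⟩ := hxy
  exact ⟨g, rfl, hx, hyz.inv_smul_mem h hy⟩

theorem sameBranch_smul (g : G) {v x y : G ⧸ K false} (hxy : SameBranch K P v x y) :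
    SameBranch K P (g • v) (g • x) (g • y) := by
  obtain ⟨k, rfl, hx, hy⟩ := hxy
  exact ⟨g * k, rfl, by simpa [mul_smul] using hx, by simpa [mul_smul] using hy⟩

theorem isAngle_smul {a : G} (g : G) {v x y : G ⧸ K false} (hxy : IsAngle K P a v x y) :
    IsAngle K P a (g • v) (g • x) (g • y) := by
  obtain ⟨k, rfl, hx⟩ := hxy
  exact ⟨g * k, rfl, by simpa [mul_smul] using hx⟩

theorem sameBranch_total (h : SyllableDecomposition C K P) {v w : G ⧸ K false} (x : G ⧸ K false)
    (hvw : v ≠ w) : SameBranch K P v x w ∨ SameBranch K P w x v := by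
  obtain ⟨g, rfl, hg⟩ := h.exists_inv_smul_mem_cone hvw.symm
  obtain ⟨k, rfl, hk⟩ := h.exists_inv_smul_mem_cone hvw
  obtain ⟨z, rfl⟩ := QuotientGroup.mk_surjective x
  by_cases hx : k⁻¹ • (z : G ⧸ K false) ∈ cone K P
  · exact Or.inr ⟨k, rfl, hx, hk⟩
  refine Or.inl ⟨g, rfl, ?_, hg⟩
  rw [MulAction.Quotient.smul_mk, smul_eq_mul, h.mk_mem_cone] at *
  rcases h.mul_mem_or true hg with hmul | hmul
  · exact absurd (hmul _ hk) (by simpa [mul_assoc] using h.one_notMem true)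
  · simpa [mul_assoc] using hmul _ hx

theorem finite_not_sameBranch (h : SyllableDecomposition C K P) (x y : G ⧸ K false) :
    {v | ¬ SameBranch K P v x y}.Finite := by
  have htrans : ∀ x y z : G ⧸ K false, {v | ¬ SameBranch K P v x y}.Finite →
      {v | ¬ SameBranch K P v y z}.Finite → {v | ¬ SameBranch K P v x z}.Finite := by
    intro x y z hxy hyz
    refine (hxy.union hyz).subset fun v hv => ?_
    by_contra hcon
    simp only [Set.mem_union, Set.mem_ofPred_eq, not_or, not_not] at hcon
    exact hv (h.sameBranch_trans hcon.1 hcon.2)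
  have hself : ∀ k s : G, s ∈ K false →
      {v | ¬ SameBranch K P v (k : G ⧸ K false) ((k * s : G) : G ⧸ K false)}.Finite := by
    intro k s hs
    rw [QuotientGroup.mk_mul_of_mem k hs]
    refine (Set.finite_singleton (k : G ⧸ K false)).subset fun v hv => ?_
    by_contra hne
    obtain ⟨g, hg, hgx⟩ := h.exists_inv_smul_mem_cone (Ne.symm hne)
    exact hv ⟨g, hg, hgx, hgx⟩
  have hstep : ∀ k s : G, s ∈ K true →
      {v | ¬ SameBranch K P v (k : G ⧸ K false) ((k * s : G) : G ⧸ K false)}.Finite := by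
    intro k s hs
    refine (Set.toFinite {(k : G ⧸ K false), ((k * s : G) : G ⧸ K false)}).subset fun v hv => ?_
    by_contra hne
    simp only [Set.mem_insert_iff, Set.mem_singleton_iff, not_or] at hne
    obtain ⟨g, rfl, hgx⟩ := h.exists_inv_smul_mem_cone (Ne.symm hne.1)
    refine hv ⟨g, rfl, hgx, ?_⟩
    rw [MulAction.Quotient.smul_mk, smul_eq_mul, h.mk_mem_cone] at *
    rw [← mul_assoc]
    by_cases hgk : g⁻¹ * k ∈ K true
    · refine h.mem_of_mem (MulMemClass.mul_mem hgk hs) fun hC => hne.2 (QuotientGroup.eq.2 ?_)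
      rw [← mul_assoc]
      exact h.base_le false hC
    · exact (h.mul_mem_iff_of_notMem hs hgk).2 hgx
  suffices ∀ g k : G,
      {v | ¬ SameBranch K P v (k : G ⧸ K false) ((k * g : G) : G ⧸ K false)}.Finite by
    obtain ⟨k, rfl⟩ := QuotientGroup.mk_surjective x
    obtain ⟨g, rfl⟩ := QuotientGroup.mk_surjective y
    simpa using this (k⁻¹ * g) k
  refine h.induction _ (fun c hc k => hself k c (h.base_le _ hc)) fun i s r hs _ _ ih k => ?_
  rw [← mul_assoc]
  refine htrans _ _ _ ?_ (ih (k * s))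
  cases i
  · exact hself k s hs
  · exact hstep k s hs

/-- The branches and angles of the Bass–Serre tree. -/
theorem branchSystem (h : SyllableDecomposition C K P) {a : G} (ha : a ∈ K false) (haC : a ∉ C) :
    BranchSystem (SameBranch K P) (IsAngle K P a) where
  refl hx :=
    let ⟨g, hg, hgx⟩ := h.exists_inv_smul_mem_cone hx
    ⟨g, hg, hgx, hgx⟩
  ne := by
    rintro _ x y ⟨g, rfl, hx, -⟩
    exact h.ne_of_inv_smul_mem_cone hx
  symm := sameBranch_comm
  trans := h.sameBranch_trans
  big_symm := by
    rintro v x y ⟨g, hg, hx⟩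
    exact ⟨g, hg, hx.symm⟩
  big_ne := by
    rintro _ x y ⟨g, rfl, ⟨hx, -⟩ | ⟨-, hx⟩⟩
    · exact h.ne_of_inv_smul_mem_cone hx
    · rw [← QuotientGroup.mk_mul_of_mem g ha]
      exact h.ne_of_inv_smul_mem_cone hx
  big_not := by
    rintro _ x y ⟨g, rfl, hxy⟩ hE
    have key : ∀ {z : G ⧸ K false}, g⁻¹ • z ∈ cone K P → (g * a)⁻¹ • z ∈ cone K P → False := by
      intro z hz hz'
      refine haC ?_
      simpa using h.inv_mul_mem_base (QuotientGroup.mk_mul_of_mem g ha).symm hz hz'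
    rcases hxy with ⟨hx, hy⟩ | ⟨hy, hx⟩
    · exact key (hE.inv_smul_mem h hx) hy
    · exact key ((sameBranch_comm hE).inv_smul_mem h hy) hx
  big_congr := by
    rintro _ x x' y hE ⟨g, rfl, ⟨hx, hy⟩ | ⟨hy, hx⟩⟩
    · exact ⟨g, rfl, Or.inl ⟨hE.inv_smul_mem h hx, hy⟩⟩
    · rw [← QuotientGroup.mk_mul_of_mem g ha] at hE
      exact ⟨g, rfl, Or.inr ⟨hy, hE.inv_smul_mem h hx⟩⟩
  total := h.sameBranch_total
  finite := h.finite_not_sameBranch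

theorem eq_one_of_isAngle (h : SyllableDecomposition C K P) {a : G} (ha : a ∈ K false)
    (hmal : ∀ c ∈ C, a⁻¹ * c * a ∈ C → c = 1) {g : G} {v x y : G ⧸ K false}
    (hxy : IsAngle K P a v x y) (hv : g • v = v) (hx : SameBranch K P v (g • x) x)
    (hy : SameBranch K P v (g • y) y) : g = 1 := by
  obtain ⟨k, rfl, hk⟩ := hxy
  have hu : k⁻¹ * g * k ∈ K false := by
    rw [mul_assoc]
    exact QuotientGroup.eq.1 hv.symm
  have key : ∀ {x y : G ⧸ K false}, SameBranch K P k (g • x) x → SameBranch K P k (g • y) y →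
      k⁻¹ • x ∈ cone K P → (k * a)⁻¹ • y ∈ cone K P → g = 1 := by
    intro x y hx hy hkx hky
    have hux := (sameBranch_comm hx).inv_smul_mem h hkx
    rw [← QuotientGroup.mk_mul_of_mem k ha] at hy
    have huy := (sameBranch_comm hy).inv_smul_mem h hky
    have huC : k⁻¹ * g * k ∈ C := h.mem_base_of_cone hu hkx (by simpa [smul_smul] using hux)
    have hua : a⁻¹ * (k⁻¹ * g * k) * a ∈ C :=
      h.mem_base_of_cone (MulMemClass.mul_mem (MulMemClass.mul_mem (inv_mem ha) hu) ha) hky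
        (by simpa [smul_smul, mul_assoc] using huy)
    have := hmal _ huC hua
    rwa [mul_assoc, inv_mul_eq_one, eq_comm, mul_eq_right] at this
  rcases hk with ⟨h1, h2⟩ | ⟨h1, h2⟩
  · exact key hx hy h1 h2
  · exact key hy hx h1 h2

theorem le_angleDist_pow (h : SyllableDecomposition C K P) {a b : G} (ha : a ∈ K false)
    (haC : a ∉ C) (hb : b ∈ K true) (hbC : b ∉ C) (k : ℕ) :
    k ≤ BranchSystem.angleDist (IsAngle K P a) ((1 : G) : G ⧸ K false)
      (((a * b) ^ k : G) : G ⧸ K false) := by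
  have hpow : ∀ m : ℕ, b * (a * b) ^ m ∈ P true := by
    intro m
    induction m with
    | zero => simpa using h.mem_of_mem hb hbC
    | succ m ih =>
      rw [pow_succ']
      simp only [mul_assoc] at ih ⊢
      exact h.mul_mem_of_mem hb hbC (h.mul_mem_of_mem ha haC ih (by simp)) (by simp)
  have hinv : ∀ m : ℕ, ((a * b)⁻¹) ^ (m + 1) ∈ P true := by
    have ha' := mt inv_mem_iff.1 haC
    have hb' := mt inv_mem_iff.1 hbC
    intro m
    induction m with
    | zero =>
      rw [zero_add, pow_one, mul_inv_rev]
      exact h.mul_mem_of_mem (inv_mem hb) hb' (h.mem_of_mem (inv_mem ha) ha') (by simp)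
    | succ m ih =>
      rw [pow_succ', mul_inv_rev, mul_assoc, ← mul_inv_rev]
      exact h.mul_mem_of_mem (inv_mem hb) hb'
        (h.mul_mem_of_mem (inv_mem ha) ha' ih (by simp)) (by simp)
  have hnotMem : ∀ m : ℕ, (a * b) ^ (m + 1) ∉ K false := by
    intro m hm
    have := hpow m
    rw [pow_succ', mul_assoc, Subgroup.mul_mem_cancel_left _ ha] at hm
    exact Bool.false_ne_true (h.eq_of_mem hm this).symm
  have hinj : Function.Injective fun m : ℕ => (((a * b) ^ m : G) : G ⧸ K false) := by
    intro i j hij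
    by_contra hne
    wlog hlt : i < j generalizing i j
    · exact this hij.symm (Ne.symm hne) (lt_of_le_of_ne (not_lt.1 hlt) (Ne.symm hne))
    obtain ⟨m, rfl⟩ := Nat.exists_eq_add_of_lt hlt
    refine hnotMem m ?_
    have := QuotientGroup.eq.1 hij
    rwa [add_assoc, pow_add, inv_mul_cancel_left] at this
  have hangle : ∀ m ∈ Finset.Ioo 0 k, IsAngle K P a (((a * b) ^ m : G) : G ⧸ K false)
      ((1 : G) : G ⧸ K false) (((a * b) ^ k : G) : G ⧸ K false) := by
    intro m hm
    obtain ⟨h0, hk⟩ := Finset.mem_Ioo.1 hm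
    obtain ⟨i, rfl⟩ := Nat.exists_eq_succ_of_ne_zero h0.ne'
    obtain ⟨j, rfl⟩ := Nat.exists_eq_add_of_lt hk
    refine ⟨_, rfl, Or.inl ⟨?_, ?_⟩⟩
    · rw [MulAction.Quotient.smul_mk, smul_eq_mul, h.mk_mem_cone, mul_one, ← inv_pow]
      exact hinv i
    · rw [MulAction.Quotient.smul_mk, smul_eq_mul, h.mk_mem_cone, mul_inv_rev, add_assoc, pow_add,
        mul_assoc, inv_mul_cancel_left, pow_succ', mul_assoc, inv_mul_cancel_left]
      exact hpow j
  rcases Nat.lt_or_ge k 2 with hk | hk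
  · interval_cases k
    · exact Nat.zero_le _
    · rw [Nat.one_le_iff_ne_zero, Ne, BranchSystem.angleDist_eq_zero]
      exact fun he => Nat.zero_ne_one (hinj (by simpa using he))
  · have hcard : k - 1 ≤ BranchSystem.angleCount (IsAngle K P a) ((1 : G) : G ⧸ K false)
        (((a * b) ^ k : G) : G ⧸ K false) := by
      have hsub := Set.ncard_le_ncard (s := (fun m : ℕ => (((a * b) ^ m : G) : G ⧸ K false)) ''
        (Finset.Ioo 0 k : Finset ℕ)) (by rintro _ ⟨m, hm, rfl⟩; exact hangle m hm)
        ((h.branchSystem ha haC).finite_big _ _)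
      rw [Set.ncard_image_of_injective _ hinj, Set.ncard_coe_finset, Nat.card_Ioo] at hsub
      simpa [BranchSystem.angleCount] using hsub
    have hne : ((1 : G) : G ⧸ K false) ≠ (((a * b) ^ k : G) : G ⧸ K false) := fun he =>
      absurd (hinj (a₁ := 0) (a₂ := k) (by simpa using he)) (by omega)
    rw [BranchSystem.angleDist, if_neg hne]
    omega

/-- An amalgam with an element of one factor whose conjugate meets the base trivially acts
acylindrically, with unbounded orbits, on a hyperbolic geodesic space. -/
theorem exists_goodAcylAction {G : Type} [Group G] {C : Subgroup G} {K : Bool → Subgroup G}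
    {P : Bool → Set G} (h : SyllableDecomposition C K P) {a b : G} (ha : a ∈ K false)
    (haC : a ∉ C) (hmal : ∀ c ∈ C, a⁻¹ * c * a ∈ C → c = 1) (hb : b ∈ K true) (hbC : b ∉ C) :
    ∃ (X : Type) (m : MetricSpace X) (act : G → X → X), @GoodAcylAction G _ X m act := by
  have hB := h.branchSystem ha haC
  let _ : GraphDist (G ⧸ K false) :=
    { d := BranchSystem.angleDist (IsAngle K P a)
      eq_zero := BranchSystem.angleDist_eq_zero
      comm := hB.angleDist_comm
      triangle := hB.angleDist_triangle
      interpolate := hB.exists_angleDist_eq_one }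
  have hA : ∀ (g : G) (v x y : G ⧸ K false), IsAngle K P a v x y →
      IsAngle K P a (g • v) (g • x) (g • y) := fun g _ _ _ => isAngle_smul g
  have _ : GraphDist.IsometricAction G (G ⧸ K false) := ⟨BranchSystem.angleDist_smul hA⟩
  exact ⟨_, _, _, GraphDist.goodAcylAction (G := G) (V := G ⧸ K false) zero_le_four
    hB.angleDist_hyperbolic
    (hB.exists_acylindricity_constants (fun g _ _ _ => sameBranch_smul g) hA
      fun g v x y hxy hv hx hy => h.eq_one_of_isAngle ha hmal hxy hv hx hy)
    (x₀ := ((1 : G) : G ⧸ K false)) fun k =>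
      ⟨(a * b) ^ k, by
        rw [MulAction.Quotient.smul_mk, smul_eq_mul, mul_one]
        exact h.le_angleDist_pow ha haC hb hbC k⟩⟩

section Map

variable {ι κ F Q : Type*} [Group F] [Group Q] {KF : ι → Subgroup F} {PF : ι → Set F}
  {E : Subgroup Q} {K : κ → Subgroup Q} {P : κ → Set Q} {σ : ι → κ} {f : F →* Q}

/-- A homomorphism from a free product to an amalgam preserves first syllables if it is compatible
with the factors and maps no nontrivial element of a factor to the base. -/
theorem map_mem_of_mem (hF : SyllableDecomposition ⊥ KF PF) (hQ : SyllableDecomposition E K P)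
    (hσ : Function.Injective σ) (hf : ∀ i, ∀ x ∈ KF i, f x ∈ K (σ i))
    (hE : ∀ i, ∀ x ∈ KF i, f x ∈ E → x = 1) (c : F) : ∀ i, c ∈ PF i → f c ∈ P (σ i) := by
  refine hF.induction (fun c => ∀ i, c ∈ PF i → f c ∈ P (σ i))
    (fun c hc i hci => absurd hci (hF.notMem_of_mem_base hc)) (fun j x r hx hx1 hr ih i hi => ?_) c
  obtain rfl := hF.disjoint (hF.mul_mem hx hx1 hr) hi
  rw [map_mul]
  refine hQ.mul_mem (hf _ x hx) (fun h => hx1 (hE _ x hx h)) fun hfr => ?_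
  by_cases hr1 : r ∈ (⊥ : Subgroup F)
  · rw [Subgroup.mem_bot.1 hr1, map_one] at hfr
    exact hQ.one_notMem _ hfr
  · obtain ⟨l, -, hl, -⟩ := hF.exists_last hr1
    obtain rfl := hσ (hQ.disjoint hfr (ih l hl))
    exact hr hl

theorem map_notMem_of_notMem (hF : SyllableDecomposition ⊥ KF PF)
    (hQ : SyllableDecomposition E K P) (hσ : Function.Injective σ)
    (hf : ∀ i, ∀ x ∈ KF i, f x ∈ K (σ i)) (hE : ∀ i, ∀ x ∈ KF i, f x ∈ E → x = 1) {c : F} {i : ι}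
    (hc : c ∉ PF i) : f c ∉ P (σ i) := by
  intro hfc
  by_cases hc1 : c ∈ (⊥ : Subgroup F)
  · rw [Subgroup.mem_bot.1 hc1, map_one] at hfc
    exact hQ.one_notMem _ hfc
  · obtain ⟨l, -, hl, -⟩ := hF.exists_last hc1
    obtain rfl := hσ (hQ.disjoint hfc (hF.map_mem_of_mem hQ hσ hf hE c l hl))
    exact hc hl

theorem eq_one_of_map_mem_base (hF : SyllableDecomposition ⊥ KF PF)
    (hQ : SyllableDecomposition E K P) (hσ : Function.Injective σ)
    (hf : ∀ i, ∀ x ∈ KF i, f x ∈ K (σ i)) (hE : ∀ i, ∀ x ∈ KF i, f x ∈ E → x = 1) {c : F}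
    (hc : f c ∈ E) : c = 1 := by
  by_contra hc1
  obtain ⟨l, -, hl, -⟩ := hF.exists_last (mt Subgroup.mem_bot.1 hc1)
  exact hQ.notMem_of_mem_base hc (hF.map_mem_of_mem hQ hσ hf hE c l hl)

end Map

/-- A criterion for the conjugate of the image of a free product by `u * y` to intersect that
image trivially. -/
theorem eq_one_of_mul_eq {F Q : Type*} [Group F] [Group Q] {KF : Bool → Subgroup F}
    {PF : Bool → Set F} {E : Subgroup Q} {K : Bool → Subgroup Q} {P : Bool → Set Q} {f : F →* Q}
    (hF : SyllableDecomposition ⊥ KF PF) (hQ : SyllableDecomposition E K P)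
    (hf : ∀ i, ∀ x ∈ KF i, f x ∈ K i) (hE : ∀ i, ∀ x ∈ KF i, f x ∈ E → x = 1) {u y : Q}
    (hu : u ∈ K true) (hy : y ∈ K false) (hyf : ∀ x ∈ KF false, y * f x ∉ E)
    (hfu : ∀ x ∈ KF true, f x * u ∉ E) (huf : ∀ x ∈ KF true, u⁻¹ * f x ∉ E)
    (hufu : ∀ x ∈ KF true, x ≠ 1 → u⁻¹ * f x * u ∉ E) {c c' : F}
    (hc : f c * (u * y) = u * y * f c') : c = 1 := by
  have hmap : ∀ {r i}, r ∉ PF i → f r ∉ P i :=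
    fun hr => hF.map_notMem_of_notMem (σ := id) hQ Function.injective_id hf hE hr
  have hmem : ∀ r i, r ∈ PF i → f r ∈ P i :=
    hF.map_mem_of_mem (σ := id) hQ Function.injective_id hf hE
  have huE : u ∉ E := by simpa using hfu 1 (one_mem _)
  have hyE : y ∉ E := by simpa using hyf 1 (one_mem _)
  have hyP : y ∈ P false := hQ.mem_of_mem hy hyE
  have huyP : u * y ∈ P true := hQ.mul_mem_of_mem hu huE hyP (by simp)
  have hq : y * f c' ∈ P false := by
    refine hF.induction (fun c' => y * f c' ∈ P false) (fun c hc => ?_)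
      (fun i x r hx hx1 hr _ => ?_) c'
    · rwa [Subgroup.mem_bot.1 hc, map_one, mul_one]
    · cases i
      · rw [map_mul, ← mul_assoc]
        exact hQ.mul_mem (MulMemClass.mul_mem hy (hf _ x hx)) (hyf x hx) (hmap hr)
      · exact hQ.mul_mem_of_mem hy hyE (hmem _ _ (hF.mul_mem hx hx1 hr)) (by simp)
  have hr : ∀ r i, r ∈ PF i → f r * (u * y) ∈ P i := by
    refine hF.induction _ (fun c hc i hci => absurd hci (hF.notMem_of_mem_base hc))
      fun j x r hx hx1 hr ih i hi => ?_
    obtain rfl := hF.disjoint (hF.mul_mem hx hx1 hr) hi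
    have hfx : f x ∉ E := fun h => hx1 (hE _ x hx h)
    by_cases hr1 : r ∈ (⊥ : Subgroup F)
    · rw [Subgroup.mem_bot.1 hr1, mul_one]
      cases j
      · exact hQ.mul_mem_of_mem (hf _ x hx) hfx huyP (by simp)
      · rw [← mul_assoc]
        exact hQ.mul_mem_of_mem (MulMemClass.mul_mem (hf _ x hx) hu) (hfu x hx) hyP (by simp)
    · obtain ⟨l, -, hl, -⟩ := hF.exists_last hr1
      rw [map_mul, mul_assoc]
      refine hQ.mul_mem_of_mem (hf _ x hx) hfx (ih l hl) ?_
      rintro rfl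
      exact hr hl
  have huq : u * (y * f c') ∈ P true := hQ.mul_mem_of_mem hu huE hq (by simp)
  rw [mul_assoc u y] at hc
  revert hc
  refine hF.induction (fun c => f c * (u * y) = u * (y * f c') → c = 1)
    (fun c hc _ => Subgroup.mem_bot.1 hc) (fun i x r hx hx1 hrP _ hc => ?_) c
  exfalso
  cases i
  · exact Bool.false_ne_true (hQ.disjoint (hc ▸ hr _ _ (hF.mul_mem hx hx1 hrP)) huq)
  · rw [map_mul, mul_assoc, ← inv_mul_eq_iff_eq_mul] at hc
    refine Bool.false_ne_true (hQ.disjoint hq (hc ▸ ?_))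
    have hux : u⁻¹ * f x ∈ K true := MulMemClass.mul_mem (inv_mem hu) (hf _ x hx)
    by_cases hr1 : r ∈ (⊥ : Subgroup F)
    · rw [Subgroup.mem_bot.1 hr1, map_one, one_mul, ← mul_assoc, ← mul_assoc]
      exact hQ.mul_mem_of_mem (MulMemClass.mul_mem hux hu)
        (hufu x hx fun h => hx1 (Subgroup.mem_bot.2 h)) hyP (by simp)
    · obtain ⟨l, -, hl, -⟩ := hF.exists_last hr1
      rw [← mul_assoc]
      refine hQ.mul_mem_of_mem hux (huf x hx) (hr _ _ hl) ?_
      rintro rfl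
      exact hrP hl

end SyllableDecomposition

namespace Higman

open Monoid

/-- The free group of rank two, as the free product of two infinite cyclic groups. -/
abbrev RankTwo : Type := PushoutI fun _ : Bool => (1 : Unit →* Multiplicative ℤ)

namespace RankTwo

/-- The standard generators of the free group of rank two. -/
def gen (i : Bool) : RankTwo := PushoutI.of i (Multiplicative.ofAdd (1 : ℤ))

/-- The homomorphism from the free group of rank two with given values on the generators. -/
def lift {M : Type*} [Group M] (s : Bool → M) : RankTwo →* M :=
  PushoutI.lift (fun i => zpowersHom M (s i)) 1 fun _ => by ext; simp

variable {M : Type*} [Group M]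

theorem of_eq_gen_zpow (i : Bool) (z : Multiplicative ℤ) :
    (PushoutI.of i z : RankTwo) = gen i ^ z.toAdd := by
  rw [gen, ← map_zpow, ← ofAdd_zsmul, smul_eq_mul, mul_one, ofAdd_toAdd]

@[simp]
theorem lift_gen (s : Bool → M) (i : Bool) : lift s (gen i) = s i := by
  simp [lift, gen, PushoutI.lift_of]

theorem hom_ext {f g : RankTwo →* M} (h : ∀ i, f (gen i) = g (gen i)) : f = g := by
  refine PushoutI.hom_ext (fun i => MonoidHom.ext fun z => ?_) (MonoidHom.ext fun z => ?_)
  · simp [of_eq_gen_zpow, h]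
  · rw [Subsingleton.elim z 1, map_one, map_one]

theorem exists_syllableDecomposition : ∃ P : Bool → Set RankTwo,
    SyllableDecomposition ⊥ (fun i => Subgroup.zpowers (gen i)) P := by
  obtain ⟨P, hP⟩ := PushoutI.exists_syllableDecomposition
    (φ := fun _ : Bool => (1 : Unit →* Multiplicative ℤ))
    (fun _ => Function.injective_of_subsingleton _)
  have hbase : (PushoutI.base fun _ : Bool => (1 : Unit →* Multiplicative ℤ)).range = ⊥ := by
    rw [MonoidHom.range_eq_bot_iff]
    exact MonoidHom.ext fun z => by rw [Subsingleton.elim z 1, map_one, map_one]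
  have hfac : (fun i => Subgroup.zpowers (gen i)) = fun i => (PushoutI.of
      (φ := fun _ : Bool => (1 : Unit →* Multiplicative ℤ)) i).range := by
    funext i
    ext g
    rw [Subgroup.mem_zpowers_iff, MonoidHom.mem_range]
    constructor
    · rintro ⟨k, rfl⟩
      exact ⟨Multiplicative.ofAdd k, of_eq_gen_zpow i _⟩
    · rintro ⟨z, rfl⟩
      exact ⟨z.toAdd, (of_eq_gen_zpow i z).symm⟩
  rw [hbase] at hP
  rw [hfac]
  exact ⟨P, hP⟩

end RankTwo

/-- The translation `x ↦ x + 1` of `ℚ`. -/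
def shift : Equiv.Perm ℚ := Equiv.addRight 1

/-- The dilation `x ↦ 2 * x` of `ℚ`. -/
def dbl : Equiv.Perm ℚ := MulAction.toPermHom ℚˣ ℚ (Units.mk0 2 two_ne_zero)

theorem shift_zpow_apply (k : ℤ) (x : ℚ) : (shift ^ k) x = x + k := by
  simp [shift]

theorem dbl_zpow_apply (k : ℤ) (x : ℚ) : (dbl ^ k) x = 2 ^ k * x := by
  rw [dbl, ← map_zpow, MulAction.toPermHom_apply, MulAction.toPerm_apply, Units.smul_def]
  simp

theorem shift_apply (x : ℚ) : shift x = x + 1 := rfl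

theorem dbl_apply (x : ℚ) : dbl x = 2 * x := rfl

theorem shift_inv_apply (x : ℚ) : shift⁻¹ x = x - 1 := by
  rw [Equiv.Perm.inv_eq_iff_eq, shift_apply]
  ring

theorem dbl_inv_apply (x : ℚ) : dbl⁻¹ x = x / 2 := by
  rw [Equiv.Perm.inv_eq_iff_eq, dbl_apply]
  ring

theorem dbl_mul_shift : dbl * shift * dbl⁻¹ * (shift⁻¹) ^ 2 = 1 := by
  ext x
  simp only [pow_two, Equiv.Perm.mul_apply, Equiv.Perm.one_apply, shift_inv_apply, dbl_inv_apply,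
    shift_apply, dbl_apply]
  ring

/-- The inclusions of the infinite cyclic group as translations and as dilations. -/
def cyclicMap (i : Bool) : Multiplicative ℤ →* Equiv.Perm ℚ :=
  zpowersHom _ (cond i dbl shift)

theorem cyclicMap_injective (i : Bool) : Function.Injective (cyclicMap i) := by
  rw [injective_iff_map_eq_one]
  intro z hz
  have h := DFunLike.congr_fun hz 1
  cases i
  · simpa [cyclicMap, shift_zpow_apply] using h
  · have h' : (2 : ℚ) ^ z.toAdd = 1 := by simpa [cyclicMap, dbl_zpow_apply] using h
    exact toAdd_eq_zero.1 (zpow_right_injective₀ two_pos (by norm_num : (2 : ℚ) ≠ 1)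
      (h'.trans (zpow_zero _).symm))

/-- Two copies of the affine group, glued along translations of the first and dilations of the
second. -/
abbrev Model : Type := PushoutI cyclicMap

namespace Model

/-- The inclusion of the two factors. -/
abbrev incl (i : Bool) : Equiv.Perm ℚ →* Model := PushoutI.of (φ := cyclicMap) i

/-- The image of the amalgamated subgroup. -/
abbrev edge : Subgroup Model := (PushoutI.base cyclicMap).range

theorem incl_injective (i : Bool) : Function.Injective (incl i) :=
  PushoutI.of_injective cyclicMap_injective i

theorem incl_shift : incl false shift = incl true dbl := by
  have h1 := PushoutI.of_apply_eq_base cyclicMap false (Multiplicative.ofAdd (1 : ℤ))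
  have h2 := PushoutI.of_apply_eq_base cyclicMap true (Multiplicative.ofAdd (1 : ℤ))
  simpa [cyclicMap] using h1.trans h2.symm

theorem exists_of_incl_false_mem {p : Equiv.Perm ℚ} (h : incl false p ∈ edge) :
    ∃ k : ℤ, ∀ x, p x = x + k := by
  obtain ⟨z, hz⟩ := h
  rw [← PushoutI.of_apply_eq_base cyclicMap false] at hz
  refine ⟨z.toAdd, fun x => ?_⟩
  rw [← incl_injective false hz, ← shift_zpow_apply]
  simp [cyclicMap]

theorem apply_zero_of_incl_true_mem {p : Equiv.Perm ℚ} (h : incl true p ∈ edge) : p 0 = 0 := by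
  obtain ⟨z, hz⟩ := h
  rw [← PushoutI.of_apply_eq_base cyclicMap true] at hz
  rw [← incl_injective true hz]
  simp [cyclicMap, dbl_zpow_apply]

end Model

/-- The element of each factor of the model which, together with its counterpart, generates a free
subgroup. -/
def freeGen (i : Bool) : Equiv.Perm ℚ := cond i shift dbl

theorem eq_zero_of_incl_freeGen_zpow_mem {i : Bool} {k : ℤ}
    (h : Model.incl i (freeGen i ^ k) ∈ Model.edge) : k = 0 := by
  cases i
  · obtain ⟨m, hm⟩ := Model.exists_of_incl_false_mem h
    have h0 := hm 0
    have h1 := hm 1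
    simp only [freeGen, cond_false, dbl_zpow_apply, mul_zero, zero_add, mul_one] at h0 h1
    rw [← h0, add_zero] at h1
    exact zpow_right_injective₀ two_pos (by norm_num : (2 : ℚ) ≠ 1) (h1.trans (zpow_zero _).symm)
  · have h0 := Model.apply_zero_of_incl_true_mem h
    simpa [freeGen, shift_zpow_apply] using h0

/-- The relators of the group on three generators, each conjugating the next one to its square. -/
def tripleRels : Set (FreeGroup (Fin 3)) :=
  {FreeGroup.of 0 * FreeGroup.of 1 * (FreeGroup.of 0)⁻¹ * ((FreeGroup.of 1)⁻¹) ^ 2,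
    FreeGroup.of 1 * FreeGroup.of 2 * (FreeGroup.of 1)⁻¹ * ((FreeGroup.of 2)⁻¹) ^ 2}

/-- The amalgam of two Baumslag–Solitar groups on three generators. -/
abbrev Triple : Type := PresentedGroup tripleRels

namespace Triple

/-- The standard generators. -/
def gen (j : Fin 3) : Triple := PresentedGroup.of j

/-- The homomorphism with given values on the generators. -/
def lift {M : Type*} [Group M] (s : Fin 3 → M) (h₀ : s 0 * s 1 * (s 0)⁻¹ * ((s 1)⁻¹) ^ 2 = 1)
    (h₁ : s 1 * s 2 * (s 1)⁻¹ * ((s 2)⁻¹) ^ 2 = 1) : Triple →* M :=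
  PresentedGroup.toGroup (rels := tripleRels) (f := s) <| by
    rintro r (rfl | rfl)
    · simpa using h₀
    · simpa using h₁

@[simp]
theorem lift_gen {M : Type*} [Group M] (s : Fin 3 → M) (h₀ h₁) (j : Fin 3) :
    lift s h₀ h₁ (gen j) = s j :=
  PresentedGroup.toGroup.of _

theorem hom_ext {M : Type*} [Group M] {f g : Triple →* M} (h : ∀ j, f (gen j) = g (gen j)) :
    f = g :=
  PresentedGroup.ext h

theorem gen_zero_one : gen 0 * gen 1 * (gen 0)⁻¹ * ((gen 1)⁻¹) ^ 2 = 1 :=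
  PresentedGroup.one_of_mem (rels := tripleRels) (Or.inl rfl)

theorem gen_one_two : gen 1 * gen 2 * (gen 1)⁻¹ * ((gen 2)⁻¹) ^ 2 = 1 :=
  PresentedGroup.one_of_mem (rels := tripleRels) (Or.inr rfl)

/-- The homomorphism to the model. -/
def toModel : Triple →* Model :=
  lift ![Model.incl false dbl, Model.incl false shift, Model.incl true shift]
    (by simpa using congrArg (Model.incl false) dbl_mul_shift)
    (by
      simp only [Matrix.cons_val]
      rw [Model.incl_shift]
      simpa using congrArg (Model.incl true) dbl_mul_shift)

theorem toModel_gen_zero : toModel (gen 0) = Model.incl false dbl := by simp [toModel]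

theorem toModel_gen_one : toModel (gen 1) = Model.incl false shift := by simp [toModel]

theorem toModel_gen_two : toModel (gen 2) = Model.incl true shift := by simp [toModel]

/-- The two embeddings of the free group of rank two onto the subgroup generated by the first and
the last generator, differing by an exchange of the generators. -/
def side (i : Bool) : RankTwo →* Triple :=
  RankTwo.lift fun j => if j = i then gen 0 else gen 2

theorem side_gen_self (i : Bool) : side i (RankTwo.gen i) = gen 0 := by simp [side]

theorem side_gen_not (i : Bool) : side i (RankTwo.gen !i) = gen 2 := by simp [side]

theorem toModel_side_gen (i j : Bool) :
    toModel (side i (RankTwo.gen j)) = Model.incl (xor i j) (freeGen (xor i j)) := by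
  cases i <;> cases j <;> simp [side, toModel_gen_zero, toModel_gen_two, freeGen]

theorem exists_toModel_side {i j : Bool} {x : RankTwo} (hx : x ∈ Subgroup.zpowers (RankTwo.gen j)) :
    ∃ k : ℤ, x = RankTwo.gen j ^ k ∧
      toModel (side i x) = Model.incl (xor i j) (freeGen (xor i j) ^ k) := by
  obtain ⟨k, rfl⟩ := Subgroup.mem_zpowers_iff.1 hx
  exact ⟨k, rfl, by rw [map_zpow, map_zpow, toModel_side_gen, map_zpow]⟩

theorem toModel_side_mem_range {i j : Bool} {x : RankTwo}
    (hx : x ∈ Subgroup.zpowers (RankTwo.gen j)) :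
    toModel (side i x) ∈ (Model.incl (xor i j)).range := by
  obtain ⟨k, -, h⟩ := exists_toModel_side (i := i) hx
  exact ⟨_, h.symm⟩

theorem eq_one_of_toModel_side_mem_edge {i j : Bool} {x : RankTwo}
    (hx : x ∈ Subgroup.zpowers (RankTwo.gen j)) (h : toModel (side i x) ∈ Model.edge) : x = 1 := by
  obtain ⟨k, rfl, hk⟩ := exists_toModel_side (i := i) hx
  rw [hk] at h
  rw [eq_zero_of_incl_freeGen_zpow_mem h, zpow_zero]

theorem eq_one_of_toModel_side_mem {i : Bool} {c : RankTwo} (h : toModel (side i c) ∈ Model.edge) :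
    c = 1 := by
  obtain ⟨PF, hF⟩ := RankTwo.exists_syllableDecomposition
  obtain ⟨P, hP⟩ := PushoutI.exists_syllableDecomposition cyclicMap_injective
  refine hF.eq_one_of_map_mem_base (f := toModel.comp (side i)) hP (σ := xor i) ?_
    (fun j x hx => toModel_side_mem_range hx)
    (fun j x hx hxE => eq_one_of_toModel_side_mem_edge hx hxE) h
  intro j j'
  simp

theorem side_injective (i : Bool) : Function.Injective (side i) := by
  rw [injective_iff_map_eq_one]
  intro c hc
  exact eq_one_of_toModel_side_mem (i := i) (by rw [hc, map_one]; exact one_mem _)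

theorem gen_one_notMem_range (i : Bool) : gen 1 ∉ (side i).range := by
  rintro ⟨c, hc⟩
  have hmem : toModel (side i c) ∈ Model.edge := by
    rw [hc, toModel_gen_one]
    refine ⟨Multiplicative.ofAdd 1, ?_⟩
    rw [← PushoutI.of_apply_eq_base cyclicMap false]
    simp [cyclicMap]
  rw [eq_one_of_toModel_side_mem hmem, map_one] at hc
  have h := congrArg toModel hc
  rw [map_one, toModel_gen_one] at h
  have h1 := DFunLike.congr_fun (Model.incl_injective false (h.symm.trans (map_one _).symm)) 0
  simp [shift_apply] at h1

/-- An element conjugating the subgroup generated by the first and the last generator to a subgroup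
intersecting it trivially. -/
def separator : Triple := (gen 1)⁻¹ * gen 2 * gen 1 * (gen 0)⁻¹ * (gen 1)⁻¹

theorem toModel_separator : toModel separator =
    Model.incl true (dbl⁻¹ * shift * dbl) * Model.incl false (dbl⁻¹ * shift⁻¹) := by
  simp only [separator, map_mul, map_inv, toModel_gen_zero, toModel_gen_one, toModel_gen_two]
  simp only [Model.incl_shift, mul_assoc]

theorem eq_one_of_mul_separator_eq {c c' : RankTwo}
    (h : side false c * separator = separator * side false c') : c = 1 := by
  obtain ⟨PF, hF⟩ := RankTwo.exists_syllableDecomposition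
  obtain ⟨P, hP⟩ := PushoutI.exists_syllableDecomposition cyclicMap_injective
  have h' := congrArg toModel h
  rw [map_mul, map_mul, toModel_separator] at h'
  refine hF.eq_one_of_mul_eq (f := toModel.comp (side false)) hP ?_
    (fun j x hx hxE => eq_one_of_toModel_side_mem_edge hx hxE) ⟨_, rfl⟩ ⟨_, rfl⟩ ?_ ?_ ?_ ?_ h'
  · intro i x hx
    simpa using toModel_side_mem_range (i := false) hx
  · intro x hx hxE
    obtain ⟨k, rfl, hk⟩ := exists_toModel_side (i := false) hx
    rw [MonoidHom.comp_apply, hk, Bool.xor_false, ← map_mul] at hxE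
    obtain ⟨m, hm⟩ := Model.exists_of_incl_false_mem hxE
    have h0 : (-1 : ℚ) / 2 = m := by
      have h := hm 0
      simp only [freeGen, cond_false, Equiv.Perm.mul_apply, dbl_zpow_apply, dbl_inv_apply,
        shift_inv_apply] at h
      linarith
    have h1 : ((2 * m : ℤ) : ℚ) = (-1 : ℤ) := by
      push_cast
      linarith
    have h2 : 2 * m = -1 := by exact_mod_cast h1
    omega
  · intro x hx hxE
    obtain ⟨k, rfl, hk⟩ := exists_toModel_side (i := false) hx
    rw [MonoidHom.comp_apply, hk, Bool.false_xor, ← map_mul] at hxE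
    have h0 : (1 : ℚ) / 2 + k = 0 := by
      have h := Model.apply_zero_of_incl_true_mem hxE
      simp only [freeGen, cond_true, Equiv.Perm.mul_apply, dbl_inv_apply, dbl_apply,
        shift_zpow_apply, shift_apply] at h
      linarith
    have h1 : ((2 * k : ℤ) : ℚ) = (-1 : ℤ) := by
      push_cast
      linarith
    have h2 : 2 * k = -1 := by exact_mod_cast h1
    omega
  · intro x hx hxE
    obtain ⟨k, rfl, hk⟩ := exists_toModel_side (i := false) hx
    rw [MonoidHom.comp_apply, hk, Bool.false_xor, ← map_inv, ← map_mul] at hxE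
    have h0 : ((k : ℚ) * 2 - 1) / 2 = 0 := by
      have h := Model.apply_zero_of_incl_true_mem hxE
      simp only [mul_inv_rev, inv_inv, freeGen, cond_true, Equiv.Perm.mul_apply, dbl_inv_apply,
        shift_inv_apply, dbl_apply, shift_zpow_apply] at h
      linarith
    have h1 : ((2 * k : ℤ) : ℚ) = (1 : ℤ) := by
      push_cast
      linarith
    have h2 : 2 * k = 1 := by exact_mod_cast h1
    omega
  · intro x hx hx1 hxE
    obtain ⟨k, rfl, hk⟩ := exists_toModel_side (i := false) hx
    rw [MonoidHom.comp_apply, hk, Bool.false_xor, ← map_inv, ← map_mul, ← map_mul] at hxE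
    have h0 : (k : ℚ) = 0 := by
      have h := Model.apply_zero_of_incl_true_mem hxE
      simp only [mul_inv_rev, inv_inv, freeGen, cond_true, Equiv.Perm.mul_apply, dbl_inv_apply,
        shift_inv_apply, dbl_apply, shift_zpow_apply, shift_apply] at h
      linarith
    rw [Int.cast_eq_zero.1 h0, zpow_zero] at hx1
    exact hx1 rfl

end Triple

/-- Two copies of the group on three generators, glued along the free subgroups generated by the
first and the last generator, which are exchanged. -/
abbrev Amalgam : Type := PushoutI Triple.side

namespace Amalgam

/-- The inclusion of the two factors. -/
abbrev incl (i : Bool) : Triple →* Amalgam := PushoutI.of (φ := Triple.side) i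

theorem incl_injective (i : Bool) : Function.Injective (incl i) :=
  PushoutI.of_injective Triple.side_injective i

theorem incl_side (i : Bool) (c : RankTwo) :
    incl i (Triple.side i c) = PushoutI.base Triple.side c :=
  PushoutI.of_apply_eq_base Triple.side i c

theorem mem_range_side_of_incl_mem {i : Bool} {g : Triple}
    (h : incl i g ∈ (PushoutI.base Triple.side).range) : ∃ c, Triple.side i c = g := by
  obtain ⟨c, hc⟩ := h
  exact ⟨c, incl_injective i ((incl_side i c).trans hc)⟩

theorem incl_gen_zero (i : Bool) : incl i (Triple.gen 0) = incl (!i) (Triple.gen 2) := by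
  have h := Triple.side_gen_not !i
  rw [Bool.not_not] at h
  rw [← Triple.side_gen_self, incl_side, ← h, incl_side]

theorem exists_goodAcylAction :
    ∃ (X : Type) (m : MetricSpace X) (act : Amalgam → X → X), @GoodAcylAction Amalgam _ X m act := by
  obtain ⟨P, hP⟩ := PushoutI.exists_syllableDecomposition Triple.side_injective
  refine hP.exists_goodAcylAction (a := incl false Triple.separator) (b := incl true (Triple.gen 1))
    ⟨_, rfl⟩ ?_ ?_ ⟨_, rfl⟩ ?_
  · intro h
    obtain ⟨c, hc⟩ := mem_range_side_of_incl_mem h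
    have hc1 : c = 1 := Triple.eq_one_of_mul_separator_eq (c' := c) (by rw [hc])
    have hsep : Triple.separator = 1 := by rw [← hc, hc1, map_one]
    have hgen : RankTwo.gen false = 1 :=
      Triple.eq_one_of_mul_separator_eq (c' := RankTwo.gen false) (by rw [hsep, mul_one, one_mul])
    have h0 := Triple.toModel_side_gen false false
    rw [hgen, map_one, map_one] at h0
    have h1 := DFunLike.congr_fun (Model.incl_injective false ((map_one _).trans h0)) 1
    simp [freeGen, dbl_apply] at h1
  · rintro _ ⟨c, rfl⟩ h
    rw [← incl_side false, ← map_inv, ← map_mul, ← map_mul] at h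
    obtain ⟨c', hc'⟩ := mem_range_side_of_incl_mem h
    rw [Triple.eq_one_of_mul_separator_eq (c := c) (c' := c') (by rw [hc']; group), map_one]
  · intro h
    obtain ⟨c, hc⟩ := mem_range_side_of_incl_mem h
    exact Triple.gen_one_notMem_range true ⟨c, hc⟩

end Amalgam

section Generators

/-- The standard generators of the Higman group. -/
def gen (i : ZMod 4) : HigmanGroup 4 := PresentedGroup.of i

theorem gen_rel (i : ZMod 4) : gen i * gen (i + 1) * (gen i)⁻¹ * ((gen (i + 1))⁻¹) ^ 2 = 1 :=
  PresentedGroup.one_of_mem (rels := higmanRels 4) ⟨i, rfl⟩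

/-- The homomorphism from a factor of the amalgam to the Higman group. -/
def ofTriple (i : Bool) : Triple →* HigmanGroup 4 :=
  Triple.lift (cond i ![gen 2, gen 3, gen 0] ![gen 0, gen 1, gen 2])
    (by cases i; exacts [gen_rel 0, gen_rel 2]) (by cases i; exacts [gen_rel 1, gen_rel 3])

/-- The homomorphism from the amalgam to the Higman group. -/
def ofAmalgam : Amalgam →* HigmanGroup 4 :=
  PushoutI.lift ofTriple (RankTwo.lift fun j => cond j (gen 2) (gen 0)) fun i =>
    RankTwo.hom_ext fun j => by
      cases i <;> cases j <;> simp [ofTriple, Triple.side]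

/-- The images of the standard generators of the Higman group in the amalgam. -/
def amalgamGen : ZMod 4 → Amalgam :=
  ![Amalgam.incl false (Triple.gen 0), Amalgam.incl false (Triple.gen 1),
    Amalgam.incl false (Triple.gen 2), Amalgam.incl true (Triple.gen 1)]

theorem amalgamGen_rel (i : ZMod 4) : amalgamGen i * amalgamGen (i + 1) * (amalgamGen i)⁻¹ *
    ((amalgamGen (i + 1))⁻¹) ^ 2 = 1 := by
  have h01 : ∀ j, Amalgam.incl j (Triple.gen 0) * Amalgam.incl j (Triple.gen 1) *
      (Amalgam.incl j (Triple.gen 0))⁻¹ * ((Amalgam.incl j (Triple.gen 1))⁻¹) ^ 2 = 1 := fun j => by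
    simpa only [map_mul, map_pow, map_inv, map_one] using
      congrArg (Amalgam.incl j) Triple.gen_zero_one
  have h12 : ∀ j, Amalgam.incl j (Triple.gen 1) * Amalgam.incl j (Triple.gen 2) *
      (Amalgam.incl j (Triple.gen 1))⁻¹ * ((Amalgam.incl j (Triple.gen 2))⁻¹) ^ 2 = 1 := fun j => by
    simpa only [map_mul, map_pow, map_inv, map_one] using
      congrArg (Amalgam.incl j) Triple.gen_one_two
  have h2 := h01 true
  have h3 := h12 true
  rw [show Amalgam.incl true (Triple.gen 0) = Amalgam.incl false (Triple.gen 2) from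
    Amalgam.incl_gen_zero true] at h2
  rw [show Amalgam.incl true (Triple.gen 2) = Amalgam.incl false (Triple.gen 0) from
    (Amalgam.incl_gen_zero false).symm] at h3
  revert i
  exact Fin.forall_fin_succ.2 ⟨h01 false, Fin.forall_fin_succ.2 ⟨h12 false,
    Fin.forall_fin_succ.2 ⟨h2, Fin.forall_fin_one.2 h3⟩⟩⟩

/-- The homomorphism from the Higman group to the amalgam. -/
def toAmalgam : HigmanGroup 4 →* Amalgam :=
  PresentedGroup.toGroup (rels := higmanRels 4) (f := amalgamGen) <| by
    rintro _ ⟨i, rfl⟩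
    simpa only [map_mul, map_pow, map_inv, FreeGroup.lift_apply_of] using amalgamGen_rel i

@[simp]
theorem toAmalgam_gen (i : ZMod 4) : toAmalgam (gen i) = amalgamGen i :=
  PresentedGroup.toGroup.of _

theorem ofAmalgam_incl (i : Bool) (g : Triple) : ofAmalgam (Amalgam.incl i g) = ofTriple i g :=
  PushoutI.lift_of _ _ _ _

theorem ofAmalgam_amalgamGen (i : ZMod 4) : ofAmalgam (amalgamGen i) = gen i := by
  revert i
  have h : ∀ i j, ofAmalgam (Amalgam.incl i (Triple.gen j)) =
      cond i ![gen 2, gen 3, gen 0] ![gen 0, gen 1, gen 2] j := fun i j => by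
    rw [ofAmalgam_incl, ofTriple, Triple.lift_gen]
  exact Fin.forall_fin_succ.2 ⟨h false 0, Fin.forall_fin_succ.2 ⟨h false 1,
    Fin.forall_fin_succ.2 ⟨h false 2, Fin.forall_fin_one.2 (h true 1)⟩⟩⟩

theorem toAmalgam_ofTriple (i : Bool) (g : Triple) :
    toAmalgam (ofTriple i g) = Amalgam.incl i g := by
  suffices h : toAmalgam.comp (ofTriple i) = Amalgam.incl i from DFunLike.congr_fun h g
  refine Triple.hom_ext (M := Amalgam) fun j => ?_
  rw [MonoidHom.comp_apply, ofTriple, Triple.lift_gen]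
  revert j
  cases i
  · exact Fin.forall_fin_succ.2 ⟨toAmalgam_gen 0, Fin.forall_fin_succ.2 ⟨toAmalgam_gen 1,
      Fin.forall_fin_one.2 (toAmalgam_gen 2)⟩⟩
  · exact Fin.forall_fin_succ.2 ⟨(toAmalgam_gen 2).trans (Amalgam.incl_gen_zero true).symm,
      Fin.forall_fin_succ.2 ⟨toAmalgam_gen 3,
        Fin.forall_fin_one.2 ((toAmalgam_gen 0).trans (Amalgam.incl_gen_zero false))⟩⟩

/-- The Higman group on four generators as an amalgam. -/
def equivAmalgam : HigmanGroup 4 ≃* Amalgam :=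
  MonoidHom.toMulEquiv toAmalgam ofAmalgam
    (PresentedGroup.ext (rels := higmanRels 4) fun i =>
      (congrArg ofAmalgam (toAmalgam_gen i)).trans (ofAmalgam_amalgamGen i))
    (PushoutI.hom_ext_nonempty fun i => MonoidHom.ext fun g => by
      rw [MonoidHom.comp_apply, MonoidHom.comp_apply, ofAmalgam_incl, toAmalgam_ofTriple,
        MonoidHom.comp_apply, MonoidHom.id_apply])

end Generators

/-- No nontrivial powers of the first two generators commute. -/
theorem not_commute_gen_pow {m n : ℕ} (hm : m ≠ 0) (hn : n ≠ 0) :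
    ¬ Commute (gen 0 ^ m) (gen 1 ^ n) := by
  intro h
  have h1 := h.map toAmalgam
  rw [map_pow, map_pow, toAmalgam_gen, toAmalgam_gen] at h1
  have h2 : Commute (Triple.gen 0 ^ m) (Triple.gen 1 ^ n) := by
    refine Commute.of_map (Amalgam.incl_injective false) ?_
    rw [map_pow, map_pow]
    exact h1
  have h3 := h2.map Triple.toModel
  rw [map_pow, map_pow, Triple.toModel_gen_zero, Triple.toModel_gen_one, ← map_pow, ← map_pow] at h3
  have h4 := DFunLike.congr_fun (h3.of_map (Model.incl_injective false)).eq 0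
  simp only [← zpow_natCast, Equiv.Perm.mul_apply, dbl_zpow_apply, shift_zpow_apply, mul_zero,
    zero_add, Int.cast_natCast] at h4
  rw [zpow_natCast] at h4
  have hn' : (n : ℚ) ≠ 0 := Nat.cast_ne_zero.2 hn
  exact (one_lt_pow₀ (one_lt_two : (1 : ℚ) < 2) hm).ne'
    (mul_right_cancel₀ hn' (h4.trans (one_mul _).symm))

theorem not_isVirtuallyCyclic : ¬ IsVirtuallyCyclic (HigmanGroup 4) := by
  rintro ⟨H, hH, hfin⟩
  obtain ⟨m, hm, -, hm'⟩ := H.exists_pow_mem_of_index_ne_zero hfin.index_ne_zero (gen 0)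
  obtain ⟨n, hn, -, hn'⟩ := H.exists_pow_mem_of_index_ne_zero hfin.index_ne_zero (gen 1)
  exact not_commute_gen_pow hm.ne' hn.ne'
    (congrArg Subtype.val (hH.isMulCommutative.is_comm.comm (⟨_, hm'⟩ : H) ⟨_, hn'⟩))

end Higman

theorem GoodAcylAction.of_mulEquiv {G H X : Type*} [Group G] [Group H] [MetricSpace X]
    {act : H → X → X} (h : GoodAcylAction H X act) (e : G ≃* H) :
    GoodAcylAction G X fun g => act (e g) := by
  obtain ⟨hiso, hone, hmul, hgeo, hhyp, hacyl, x, hx⟩ := h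
  refine ⟨fun g => hiso _, fun x => ?_, fun g k x => ?_, hgeo, hhyp, fun r hr => ?_, x, ?_⟩
  · simp only [map_one, hone]
  · simp only [map_mul, hmul]
  · obtain ⟨L, N, hL, h⟩ := hacyl r hr
    refine ⟨L, N, hL, fun x y hxy => ?_⟩
    obtain ⟨hfin, hcard⟩ := h x y hxy
    exact ⟨hfin.preimage e.injective.injOn, (Set.ncard_preimage_of_injective_subset_range
      e.injective fun z _ => e.surjective z).trans_le hcard⟩
  · rwa [← e.surjective.range_comp] at hx

theorem higman4_acylindrically_hyperbolic :
    IsAcylindricallyHyperbolic (HigmanGroup 4) := by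
  obtain ⟨X, m, act, h⟩ := Higman.Amalgam.exists_goodAcylAction
  exact ⟨Higman.not_isVirtuallyCyclic, X, m, _, h.of_mulEquiv Higman.equivAmalgam⟩
end

section
/- For every integer n ≥ 5 and every i ∈ ℤ/nℤ, the generator a_i has infinite order in the generalised Higman group H_n; that is, no positive power of a_i is the identity element of H_n. -/
open Monoid Function

/-- The homomorphism from the free product of two infinite cyclic groups that sends the two
generators to `x` and `y`. -/
def pairHom {G : Type} [Group G] (x y : G) : CoprodI (fun _ : Bool => Multiplicative ℤ) →* G :=
  CoprodI.lift fun b => zpowersHom G (cond b x y)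

/-- The elements `x` and `y` freely generate a free group of rank two. -/
def IsFreePair {G : Type} [Group G] (x y : G) : Prop :=
  Injective (pairHom x y)

/-- The elements `x` and `y` have infinite order and generate cyclic groups with trivial
intersection. -/
def IsDisjointPair {G : Type} [Group G] (x y : G) : Prop :=
  ∀ j k : ℤ, x ^ j = y ^ k → j = 0 ∧ k = 0

@[simp]
theorem pairHom_of_true {G : Type} [Group G] (x y : G) (m : Multiplicative ℤ) :
    pairHom x y (CoprodI.of (i := true) m) = x ^ m.toAdd := by
  simp [pairHom, zpowersHom_apply]

@[simp]
theorem pairHom_of_false {G : Type} [Group G] (x y : G) (m : Multiplicative ℤ) :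
    pairHom x y (CoprodI.of (i := false) m) = y ^ m.toAdd := by
  simp [pairHom, zpowersHom_apply]

theorem IsFreePair.isDisjointPair {G : Type} [Group G] {x y : G} (h : IsFreePair x y) :
    IsDisjointPair x y := by
  intro j k hjk
  have key : (CoprodI.of (i := true) (Multiplicative.ofAdd j) :
      CoprodI (fun _ : Bool => Multiplicative ℤ)) =
      CoprodI.of (i := false) (Multiplicative.ofAdd k) := h (by simpa using hjk)
  constructor
  · simpa [← ofAdd_zsmul] using congrArg (pairHom (Multiplicative.ofAdd (1 : ℤ)) 1) key
  · simpa [← ofAdd_zsmul] using (congrArg (pairHom 1 (Multiplicative.ofAdd (1 : ℤ))) key).symm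

theorem IsFreePair.symm {G : Type} [Group G] {x y : G} (h : IsFreePair x y) :
    IsFreePair y x := by
  let swap := pairHom (G := CoprodI (fun _ : Bool => Multiplicative ℤ))
    (CoprodI.of (i := false) (Multiplicative.ofAdd (1 : ℤ)))
    (CoprodI.of (i := true) (Multiplicative.ofAdd (1 : ℤ)))
  have hswap : swap.comp swap = MonoidHom.id _ := by
    refine CoprodI.ext_hom _ _ ?_
    rintro (_ | _) <;> ext <;> simp [swap]
  have hcomp : pairHom y x = (pairHom x y).comp swap := by
    refine CoprodI.ext_hom _ _ ?_
    rintro (_ | _) <;> ext <;> simp [swap]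
  unfold IsFreePair
  rw [hcomp]
  exact h.comp (LeftInverse.injective (DFunLike.congr_fun hswap))

/-- If no nontrivial element of `L i` is mapped into the amalgamated subgroup, then the free
product of the `L i` embeds into the amalgamated product of the `G i`. -/
theorem pushoutI_lift_injective {ι : Type*} {L G : ι → Type*} {H : Type*}
    [∀ i, Group (L i)] [∀ i, Group (G i)] [Group H] {φ : ∀ i, H →* G i}
    (hφ : ∀ i, Injective (φ i)) (f : ∀ i, L i →* G i)
    (hf : ∀ i l, l ≠ 1 → f i l ∉ (φ i).range) :
    Injective (CoprodI.lift fun i => (PushoutI.of (φ := φ) i).comp (f i)) := by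
  classical
  rw [injective_iff_map_eq_one]
  intro g hg
  obtain ⟨w, rfl⟩ := CoprodI.Word.equiv.symm.surjective g
  let w' : CoprodI.Word G :=
    { toList := w.toList.map fun l => ⟨l.1, f l.1 l.2⟩
      ne_one := by
        intro l hl
        obtain ⟨l, hlw, rfl⟩ := List.mem_map.1 hl
        intro h
        exact hf l.1 l.2 (w.ne_one l hlw) ⟨1, (map_one _).trans h.symm⟩
      chain_ne := by
        rw [List.isChain_map]
        exact w.chain_ne }
  have hred : PushoutI.Reduced φ w' := by
    intro l hl
    obtain ⟨l, hlw, rfl⟩ := List.mem_map.1 hl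
    exact hf l.1 l.2 (w.ne_one l hlw)
  have hprod : PushoutI.ofCoprodI (φ := φ) w'.prod =
      CoprodI.lift (fun i => (PushoutI.of (φ := φ) i).comp (f i)) w.prod := by
    simp [w', CoprodI.Word.prod, map_list_prod, comp_def]
  have hempty : w' = .empty := by
    refine hred.eq_empty_of_mem_range hφ ?_
    rw [hprod]
    exact hg ▸ one_mem _
  have hw : w = .empty := by
    ext1
    have := congrArg CoprodI.Word.toList hempty
    simpa [w', CoprodI.Word.empty] using this
  subst hw
  rfl

/-- The amalgamated product of `A` and `B` over `H`. -/
theorem exists_amalgam {A B H : Type} [Group A] [Group B] [Group H] (f : H →* A) (g : H →* B)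
    (hf : Injective f) (hg : Injective g) :
    ∃ (P : Type) (_ : Group P) (α : A →* P) (β : B →* P),
      Injective α ∧ (∀ h, α (f h) = β (g h)) ∧
      ∀ x t, (∀ k : ℤ, k ≠ 0 → x ^ k ∉ f.range) → (∀ k : ℤ, k ≠ 0 → t ^ k ∉ g.range) →
        IsFreePair (α x) (β t) := by
  let φ : Bool → (H →* A × B) := fun b =>
    cond b ((MonoidHom.inl A B).comp f) ((MonoidHom.inr A B).comp g)
  have hφ : ∀ b, Injective (φ b) := by
    rintro (_ | _) h h' e
    · exact hg (by simpa [φ] using e)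
    · exact hf (by simpa [φ] using e)
  refine ⟨PushoutI φ, inferInstance, (PushoutI.of true).comp (MonoidHom.inl A B),
    (PushoutI.of false).comp (MonoidHom.inr A B), ?_, ?_, ?_⟩
  · exact (PushoutI.of_injective hφ true).comp fun a a' h => by simpa using h
  · intro h
    exact (PushoutI.of_apply_eq_base φ true h).trans (PushoutI.of_apply_eq_base φ false h).symm
  · intro x t hx ht
    have key := pushoutI_lift_injective hφ
      (fun b => zpowersHom (A × B) (cond b (MonoidHom.inl A B x) (MonoidHom.inr A B t))) (by
        rintro (_ | _) l hl ⟨h, e⟩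
        · exact ht l.toAdd (by simpa using hl)
            ⟨h, by simpa [φ, zpowersHom_apply, ← map_zpow] using e⟩
        · exact hx l.toAdd (by simpa using hl)
            ⟨h, by simpa [φ, zpowersHom_apply, ← map_zpow] using e⟩)
    unfold IsFreePair
    convert key using 2
    refine CoprodI.ext_hom _ _ ?_
    rintro (_ | _) <;> ext <;> simp [zpowersHom_apply]

/-- Scaling by two and translation by one realise the relation `s t s⁻¹ = t²`. -/
theorem exists_baumslagSolitar :
    ∃ s t : Equiv.Perm ℚ, s * t * s⁻¹ = t ^ 2 ∧ IsDisjointPair s t := by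
  refine ⟨MulAction.toPermHom ℚˣ ℚ (Units.mk0 2 two_ne_zero), Equiv.addRight 1, ?_, ?_⟩
  · ext x
    simp [pow_two, Equiv.Perm.mul_apply, Units.smul_def]
    ring
  · intro j k h
    have hs : ∀ (j : ℤ) (x : ℚ),
        (MulAction.toPermHom ℚˣ ℚ (Units.mk0 2 two_ne_zero) ^ j) x = 2 ^ j * x := by
      intro j x
      rw [← map_zpow]
      simp [Units.smul_def]
    have ht : ∀ (k : ℤ) (x : ℚ), (Equiv.addRight (1 : ℚ) ^ k) x = x + k := by
      intro k x
      simp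
    have h0 := DFunLike.congr_fun h 0
    have h1 := DFunLike.congr_fun h 1
    rw [hs, ht] at h0 h1
    have hk : k = 0 := by simpa using h0.symm
    subst hk
    refine ⟨?_, rfl⟩
    have : (2 : ℚ) ^ j = 1 := by simpa using h1
    exact (zpow_eq_one_iff_right₀ (by norm_num) (by norm_num)).1 this

/-- Attaching a further Baumslag–Solitar group to the end of a chain. -/
theorem exists_chain_succ {G : Type} [Group G] {m : ℕ} (b : ℕ → G)
    (hb : ∀ i < m, b i * b (i + 1) * (b i)⁻¹ = b (i + 1) ^ 2)
    (hd : IsDisjointPair (b 0) (b m)) :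
    ∃ (K : Type) (_ : Group K) (c : ℕ → K),
      (∀ i < m + 1, c i * c (i + 1) * (c i)⁻¹ = c (i + 1) ^ 2) ∧
      IsFreePair (c 0) (c (m + 1)) := by
  obtain ⟨s, t, hst, hdst⟩ := exists_baumslagSolitar
  obtain ⟨P, _, α, β, -, hαβ, hfree⟩ := exists_amalgam (zpowersHom G (b m))
    (zpowersHom (Equiv.Perm ℚ) s)
    (by
      rw [injective_iff_map_eq_one]
      intro k hk
      exact (hd 0 k.toAdd (by simpa [zpowersHom_apply] using hk.symm)).2)
    (by
      rw [injective_iff_map_eq_one]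
      intro k hk
      exact (hdst k.toAdd 0 (by simpa [zpowersHom_apply] using hk)).1)
  have hms : α (b m) = β s := by simpa [zpowersHom_apply] using hαβ (Multiplicative.ofAdd 1)
  refine ⟨P, inferInstance, fun i => if i ≤ m then α (b i) else β t, ?_, ?_⟩
  · intro i hi
    rcases Nat.lt_succ_iff_lt_or_eq.1 hi with hi | rfl
    · simp only [hi.le, Nat.succ_le_of_lt hi, if_true, ← map_mul, ← map_inv, ← map_pow, hb i hi]
    · simp only [le_refl, if_true, Nat.not_succ_le_self, if_false, hms, ← map_mul, ← map_inv,
        ← map_pow, hst]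
  · simp only [Nat.zero_le, if_true, Nat.not_succ_le_self, if_false]
    refine hfree _ _ ?_ ?_
    · rintro k hk ⟨l, hl⟩
      exact hk (hd k l.toAdd hl.symm).1
    · rintro k hk ⟨l, hl⟩
      exact hk (hdst l.toAdd k hl).2

theorem exists_chain_isFreePair (m : ℕ) :
    ∃ (K : Type) (_ : Group K) (c : ℕ → K),
      (∀ i < m + 2, c i * c (i + 1) * (c i)⁻¹ = c (i + 1) ^ 2) ∧
      IsFreePair (c 0) (c (m + 2)) := by
  induction m with
  | zero =>
    obtain ⟨s, t, hst, hdst⟩ := exists_baumslagSolitar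
    exact exists_chain_succ (m := 1) (fun i => if i = 0 then s else t)
      (by simpa using hst) (by simpa using hdst)
  | succ m ih =>
    obtain ⟨G, _, b, hb, hfree⟩ := ih
    exact exists_chain_succ b hb hfree.isDisjointPair

/-- Two chains glued along the free groups generated by their end points form a cycle. -/
theorem exists_cycle (m : ℕ) :
    ∃ (P : Type) (_ : Group P) (d : ℕ → P),
      (∀ i < m + 4, d i * d (i + 1) * (d i)⁻¹ = d (i + 1) ^ 2) ∧ d (m + 4) = d 0 ∧
      ∀ k : ℤ, d 0 ^ k = 1 → k = 0 := by
  obtain ⟨K, _, b, hb, hbfree⟩ := exists_chain_isFreePair 0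
  obtain ⟨L, _, c, hc, hcfree⟩ := exists_chain_isFreePair m
  obtain ⟨P, _, α, β, hα, hαβ, -⟩ := exists_amalgam _ _ hbfree hcfree.symm
  have h0 : α (b 0) = β (c (m + 2)) := by
    simpa using hαβ (CoprodI.of (i := true) (Multiplicative.ofAdd 1))
  have h2 : α (b 2) = β (c 0) := by
    simpa using hαβ (CoprodI.of (i := false) (Multiplicative.ofAdd 1))
  refine ⟨P, inferInstance, fun i => if i < 2 then α (b i) else β (c (i - 2)), ?_, ?_, ?_⟩
  · intro i hi
    obtain hi' | rfl | ⟨j, rfl⟩ : i < 1 ∨ i = 1 ∨ ∃ j, i = j + 2 := by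
      rcases i with _ | _ | j <;> simp
    · obtain rfl : i = 0 := by omega
      simpa [← map_mul, ← map_inv, ← map_pow] using congrArg α (hb 0 (by norm_num))
    · simpa [← h2, ← map_mul, ← map_inv, ← map_pow] using congrArg α (hb 1 (by norm_num))
    · simpa [← map_mul, ← map_inv, ← map_pow] using congrArg β (hc j (by omega))
  · simp [h0]
  · intro k hk
    refine (hbfree.isDisjointPair k 0 (hα ?_)).1
    simpa using hk

theorem higman_generator_infinite_order (n : ℕ) (hn : 5 ≤ n) (i : ZMod n) :
    ∀ k : ℕ, 0 < k → (PresentedGroup.of (rels := higmanRels n) i) ^ k ≠ 1 := by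
  obtain ⟨m, rfl⟩ : ∃ m, n = m + 4 := ⟨n - 4, by omega⟩
  obtain ⟨P, _, d, hd, hend, hinf⟩ := exists_cycle m
  have hsucc : ∀ j : ZMod (m + 4), d (j + 1).val = d (j.val + 1) := by
    intro j
    by_cases h : j.val + 1 < m + 4
    · rw [ZMod.val_add_of_lt (by rwa [ZMod.val_one'' (by omega)]), ZMod.val_one'' (by omega)]
    · have hj := ZMod.val_lt j
      have h1 : j.val + 1 = m + 4 := by omega
      have : j + 1 = 0 := by
        rw [← ZMod.natCast_zmod_val j]
        exact_mod_cast (congrArg (Nat.cast (R := ZMod (m + 4))) h1).trans (ZMod.natCast_self _)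
      rw [this, h1, hend, ZMod.val_zero]
  have hrel : ∀ r ∈ higmanRels (m + 4), FreeGroup.lift (fun j => d (j - i).val) r = 1 := by
    rintro _ ⟨j, rfl⟩
    have e : j + 1 - i = (j - i) + 1 := by ring
    simp only [map_mul, map_inv, map_pow, FreeGroup.lift_apply_of, e, hsucc]
    rw [hd _ (ZMod.val_lt _), inv_pow, mul_inv_cancel]
  intro k hk h
  have h' := congrArg (PresentedGroup.toGroup hrel) h
  rw [map_pow, PresentedGroup.toGroup.of, map_one, sub_self, ZMod.val_zero] at h'
  have := hinf k (by exact_mod_cast h')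
  omega
end

section
/- For every integer n ≥ 5, the generalised Higman group H_n is not simple: there exists a normal subgroup N of H_n with N ≠ {1} and N ≠ H_n. -/
/-- The cyclic subgroups generated by `a` and `b` are infinite and meet trivially. -/
def ZPowersIndependent {G : Type} [Group G] (a b : G) : Prop :=
  ∀ i j : ℤ, a ^ i = b ^ j → i = 0 ∧ j = 0

/-- The elements `a` and `b` freely generate a free subgroup. -/
def FreePair {G : Type} [Group G] (a b : G) : Prop :=
  Function.Injective (FreeGroup.lift (fun s : Bool => cond s a b))

lemma FreePair.symm {G : Type} [Group G] {a b : G} (h : FreePair a b) : FreePair b a := by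
  have key : FreeGroup.lift (fun s : Bool => cond s b a) =
      (FreeGroup.lift (fun s : Bool => cond s a b)).comp
        (FreeGroup.freeGroupCongr Equiv.boolNot).toMonoidHom := by
    ext s
    cases s <;> simp
  unfold FreePair
  rw [key]
  exact h.comp (FreeGroup.freeGroupCongr Equiv.boolNot).injective

lemma FreePair.zpowersIndependent {G : Type} [Group G] {a b : G} (h : FreePair a b) :
    ZPowersIndependent a b := by
  intro i j hij
  have e : FreeGroup.of true ^ i = FreeGroup.of false ^ j := h (by simpa using hij)
  have e₁ := congrArg (FreeGroup.lift fun s : Bool => cond s (Multiplicative.ofAdd (1 : ℤ)) 1) e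
  have e₂ := congrArg (FreeGroup.lift fun s : Bool => cond s 1 (Multiplicative.ofAdd (1 : ℤ))) e
  simp only [map_zpow, FreeGroup.lift_apply_of, cond_true, cond_false, one_zpow,
    ← ofAdd_zsmul] at e₁ e₂
  simpa using And.intro e₁ e₂.symm

namespace HNNExtension

variable {G : Type} [Group G] {A B : Subgroup G} (φ : A ≃* B) {z : G}

/-- The sign conditions satisfied by the head `z ^ k` and the tail `T` of the reduced word
representing a reduced word `L` in the stable letter (`true`) and `z` (`false`). -/
def MatchesWord (L : List (Bool × Bool)) (k : ℤ) (T : List (ℤˣ × G)) : Prop :=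
  match L with
  | [] => k = 0 ∧ T = []
  | (true, e) :: _ => k = 0 ∧ ∃ g T', T = (cond e 1 (-1), g) :: T'
  | (false, true) :: _ => 0 < k
  | (false, false) :: _ => k < 0

lemma exists_reducedWord_of_isReduced (hA : ∀ k : ℤ, z ^ k ∈ A → k = 0)
    (hB : ∀ k : ℤ, z ^ k ∈ B → k = 0) (L : List (Bool × Bool)) (hL : FreeGroup.IsReduced L) :
    ∃ (k : ℤ) (w : NormalWord.ReducedWord G A B), w.head = z ^ k ∧ MatchesWord L k w.toList ∧
      w.prod φ = FreeGroup.lift (fun s : Bool => cond s t (of z)) (FreeGroup.mk L) := by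
  induction L with
  | nil => exact ⟨0, .empty G A B, by simp, ⟨rfl, rfl⟩, by simp [NormalWord.ReducedWord.prod]⟩
  | cons a L ih =>
    obtain ⟨k, w, hk, hm, hw⟩ := ih (List.IsChain.tail hL)
    obtain ⟨s, e⟩ := a
    have split : FreeGroup.mk ((s, e) :: L) = FreeGroup.mk [(s, e)] * FreeGroup.mk L := by
      simp
    rw [split, map_mul, ← hw]
    cases s
    · refine ⟨k + cond e 1 (-1), ⟨z ^ (k + cond e 1 (-1)), w.toList, w.chain⟩, rfl, ?_, ?_⟩
      · rcases L with _ | ⟨⟨_ | _, _ | _⟩, L⟩ <;> cases e <;>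
          simp_all [MatchesWord, FreeGroup.isReduced_cons_cons] <;> omega
      · simp only [NormalWord.ReducedWord.prod, hk, ← mul_assoc]
        congr 1
        cases e <;> simp [FreeGroup.lift_mk, zpow_add] <;> group
    · refine ⟨0, ⟨1, (cond e 1 (-1), w.head) :: w.toList, ?_⟩, by simp, ⟨rfl, _, _, rfl⟩, ?_⟩
      · rcases hT : w.toList with _ | ⟨b, T⟩
        · simp
        · rw [List.isChain_cons_cons, ← hT]
          refine ⟨fun hmem => ?_, w.chain⟩
          have hk0 : k = 0 := by
            rw [hk] at hmem
            cases e
            · exact hB k hmem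
            · exact hA k hmem
          rcases L with _ | ⟨⟨_ | _, e'⟩, L⟩
          · simp_all [MatchesWord]
          · cases e' <;> simp_all [MatchesWord]
          · obtain ⟨-, g, T', hgT⟩ := hm
            obtain rfl : e = e' := (FreeGroup.isReduced_cons_cons.1 hL).1 rfl
            rw [hT, List.cons.injEq] at hgT
            exact (congrArg Prod.fst hgT.1).symm
      · cases e <;> simp [NormalWord.ReducedWord.prod, FreeGroup.lift_mk, mul_assoc]

lemma freePair_t_of (hA : ∀ k : ℤ, z ^ k ∈ A → k = 0) (hB : ∀ k : ℤ, z ^ k ∈ B → k = 0) :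
    FreePair (t : HNNExtension G A B φ) (of z) := by
  refine (injective_iff_map_eq_one _).2 fun x hx => ?_
  obtain ⟨k, w, hk, hm, hw⟩ :=
    exists_reducedWord_of_isReduced φ hA hB x.toWord FreeGroup.isReduced_toWord
  rw [FreeGroup.mk_toWord, hx] at hw
  have hT : w.toList = [] :=
    ReducedWord.toList_eq_nil_of_mem_of_range φ w (hw ▸ one_mem _)
  have hk0 : k = 0 := by
    refine hA k ?_
    have : of (φ := φ) (z ^ k) = 1 := by simpa [NormalWord.ReducedWord.prod, hT, hk] using hw
    rw [(of_injective φ).eq_iff' (map_one _)] at this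
    exact this ▸ one_mem A
  rw [hT, hk0] at hm
  rw [← FreeGroup.toWord_eq_nil_iff]
  generalize x.toWord = L at hm
  rcases L with _ | ⟨⟨_ | _, _ | _⟩, L⟩ <;> simp [MatchesWord] at hm ⊢

end HNNExtension

/-- The extension is the HNN extension whose stable letter conjugates `x` to `x ^ 2`. -/
lemma exists_freePair_extension {Q : Type} [Group Q] {z x : Q} (h : ZPowersIndependent z x) :
    ∃ (R : Type) (_ : Group R) (ι : Q →* R) (t : R), Function.Injective ι ∧
      t * ι x * t⁻¹ = ι x ^ 2 ∧ FreePair t (ι z) := by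
  have hx : Function.Injective (zpowersHom Q x) :=
    (injective_iff_map_eq_one _).2 fun n hn => by
      simpa using (h 0 n.toAdd (by simpa using hn.symm)).2
  have hx₂ : Function.Injective (zpowersHom Q (x ^ 2)) :=
    (injective_iff_map_eq_one _).2 fun n hn => by
      have := (h 0 (2 * n.toAdd) (by simpa [zpow_mul] using hn.symm)).2
      simpa using this
  let φ := (MonoidHom.ofInjective hx).symm.trans (MonoidHom.ofInjective hx₂)
  refine ⟨HNNExtension Q _ _ φ, inferInstance, HNNExtension.of, HNNExtension.t,
    HNNExtension.of_injective φ, ?_, HNNExtension.freePair_t_of φ ?_ ?_⟩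
  · have := HNNExtension.equiv_eq_conj (φ := φ) (MonoidHom.ofInjective hx (.ofAdd 1))
    simpa [φ, MonoidHom.ofInjective_apply] using this.symm
  · rintro k ⟨n, hn⟩
    exact (h k n.toAdd (by simpa using hn.symm)).1
  · rintro k ⟨n, hn⟩
    exact (h k (2 * n.toAdd) (by simpa [zpow_mul] using hn.symm)).1

lemma exists_amalgam_s11 {F R C : Type} [Group F] [Group R] [Group C] (f : F →* R) (g : F →* C)
    (hf : Function.Injective f) (hg : Function.Injective g) :
    ∃ (G : Type) (_ : Group G) (i : R →* G) (j : C →* G), Function.Injective i ∧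
      ∀ a, i (f a) = j (g a) := by
  let K : Bool → GrpCat.{0} := fun s => cond s (GrpCat.of R) (GrpCat.of C)
  let ψ : ∀ s, F →* K s := fun s => match s with
    | true => f
    | false => g
  have hψ : ∀ s, Function.Injective (ψ s) := by
    rintro (_ | _)
    · exact hg
    · exact hf
  refine ⟨Monoid.PushoutI ψ, inferInstance, Monoid.PushoutI.of (φ := ψ) true,
    Monoid.PushoutI.of (φ := ψ) false, Monoid.PushoutI.of_injective hψ true, fun a => ?_⟩
  exact (Monoid.PushoutI.of_apply_eq_base ψ true a).trans
    (Monoid.PushoutI.of_apply_eq_base ψ false a).symm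

lemma exists_chain_extension {Q : Type} [Group Q] {z x : Q} (h : ZPowersIndependent z x) (k : ℕ) :
    ∃ (R : Type) (_ : Group R) (ι : Q →* R) (c : ℕ → R), Function.Injective ι ∧ c 0 = ι x ∧
      (∀ i ≤ k, c (i + 1) * c i * (c (i + 1))⁻¹ = c i ^ 2) ∧ FreePair (c (k + 1)) (ι z) := by
  induction k with
  | zero =>
    obtain ⟨R, _, ι, t, hι, ht, hfree⟩ := exists_freePair_extension h
    refine ⟨R, _, ι, fun i => if i = 0 then ι x else t, hι, by simp, ?_, by simpa using hfree⟩
    intro i hi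
    obtain rfl : i = 0 := by omega
    simpa using ht
  | succ k ih =>
    obtain ⟨R, _, ι, c, hι, hc0, hc, hfree⟩ := ih
    obtain ⟨R', _, ι', t, hι', ht, hfree'⟩ :=
      exists_freePair_extension hfree.symm.zpowersIndependent
    refine ⟨R', _, ι'.comp ι, fun i => if i ≤ k + 1 then ι' (c i) else t, hι'.comp hι,
      by simp [hc0], fun i hi => ?_, by simpa using hfree'⟩
    rcases hi.lt_or_eq with hi | rfl
    · have := congrArg ι' (hc i (by omega))
      simpa [show i ≤ k by omega, show i ≤ k + 1 by omega] using this
    · simpa using ht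

/-- Amalgamate `R` along `⟨z, x⟩` with the group `⟨z, v, x | z v z⁻¹ = v², v x v⁻¹ = x²⟩`,
replaced here by a quotient in which `z` and `x` remain free. -/
lemma exists_closing_extension {R : Type} [Group R] {z x : R} (h : FreePair x z) :
    ∃ (G : Type) (_ : Group G) (ι : R →* G) (v : G), Function.Injective ι ∧
      v * ι x * v⁻¹ = ι x ^ 2 ∧ ι z * v * (ι z)⁻¹ = v ^ 2 := by
  let p : Equiv.Perm ℝ := Equiv.mulLeft₀ 2 two_ne_zero
  let q : Equiv.Perm ℝ := Equiv.addRight 1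
  have hpq : p * q * p⁻¹ = q ^ 2 := by
    rw [mul_inv_eq_iff_eq_mul]
    ext s
    simp [p, q, pow_two]
    ring
  have hind : ZPowersIndependent q p := by
    intro i j hij
    have hq : ∀ (n : ℤ) (s : ℝ), (q ^ n) s = s + n := by
      intro n s
      simp [q]
    have hp : ∀ (n : ℤ) (s : ℝ), (p ^ n) s = 2 ^ n * s := by
      intro n
      induction n using Int.induction_on with
      | zero => simp
      | succ n ih =>
        intro s
        rw [zpow_add_one, Equiv.Perm.mul_apply, ih, zpow_add_one₀ two_ne_zero, mul_assoc]
        rfl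
      | pred n ih =>
        intro s
        rw [zpow_sub_one, Equiv.Perm.mul_apply, ih, zpow_sub_one₀ two_ne_zero, mul_assoc]
        rfl
    have hi : i = 0 := by
      have := congrArg (fun σ : Equiv.Perm ℝ => σ 0) hij
      simpa [hq, hp] using this
    refine ⟨hi, ?_⟩
    have := congrArg (fun σ : Equiv.Perm ℝ => σ 1) hij
    simp only [hq, hp, hi, Int.cast_zero, add_zero, mul_one] at this
    exact (zpow_eq_one_iff_right₀ (by norm_num) (by norm_num)).1 this.symm
  obtain ⟨C, _, κ, t, hκ, ht, hfree⟩ := exists_freePair_extension hind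
  obtain ⟨G, _, ι, j, hι, hj⟩ := exists_amalgam_s11 _ _ h hfree.symm
  have hx : ι x = j (κ q) := by simpa using hj (FreeGroup.of true)
  have hz : ι z = j t := by simpa using hj (FreeGroup.of false)
  refine ⟨G, _, ι, j (κ p), hι, ?_, ?_⟩
  · rw [hx]
    simpa using congrArg (fun a => j (κ a)) hpq
  · rw [hz]
    simpa using congrArg j ht


lemma ZMod.eq_neg_one_or_val_add_one {n : ℕ} (i : ZMod (n + 1)) :
    i = -1 ∨ (i.val < n ∧ (i + 1).val = i.val + 1) := by
  rcases (Nat.le_of_lt_succ i.val_lt).lt_or_eq with h | h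
  · refine Or.inr ⟨h, ?_⟩
    have : Fact (1 < n + 1) := ⟨by omega⟩
    rw [ZMod.val_add_of_lt, ZMod.val_one]
    rw [ZMod.val_one]
    omega
  · exact Or.inl (ZMod.val_injective _ (by rw [h, ZMod.val_neg_one]))

/-- The generator `a_i` of the generalised Higman group. -/
def HigmanGroup.gen {n : ℕ} (i : ZMod n) : HigmanGroup n := PresentedGroup.of i

lemma HigmanGroup.exists_hom {n : ℕ} {G : Type} [Group G] (g : ZMod n → G)
    (hg : ∀ i, g i * g (i + 1) * (g i)⁻¹ = g (i + 1) ^ 2) :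
    ∃ f : HigmanGroup n →* G, ∀ i, f (gen i) = g i := by
  refine ⟨PresentedGroup.toGroup (f := g) ?_, fun i => PresentedGroup.toGroup.of _⟩
  rintro _ ⟨i, rfl⟩
  simp [hg]

/-- Any group containing suitable candidates `x, y, z` for three consecutive generators of a
generalised Higman group embeds in a group where they extend to a full cycle of generators. -/
lemma HigmanGroup.exists_hom_extension (k : ℕ) {Q : Type} [Group Q] {x y z : Q}
    (hxy : x * y * x⁻¹ = y ^ 2) (hyz : y * z * y⁻¹ = z ^ 2) (h : ZPowersIndependent z x) :
    ∃ (G : Type) (_ : Group G) (ι : Q →* G) (f : HigmanGroup (k + 5) →* G),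
      Function.Injective ι ∧ f (gen 0) = ι z ∧ f (gen (-2)) = ι x := by
  obtain ⟨R, _, ι, c, hι, hc0, hc, hfree⟩ := exists_chain_extension h k
  obtain ⟨G, _, κ, v, hκ, hv, hv'⟩ := exists_closing_extension hfree
  let w : ℕ → G := fun j =>
    if j = 0 then κ (ι z) else if j = 1 then v else if j = k + 4 then κ (ι y)
    else κ (c (k + 3 - j))
  have hw : ∀ j < k + 4, w j * w (j + 1) * (w j)⁻¹ = w (j + 1) ^ 2 := by
    intro j hj
    rcases j with _ | _ | j
    · simpa [w] using hv'
    · simpa [w] using hv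
    · rcases (show j ≤ k + 1 by omega).lt_or_eq with hj | rfl
      · have := congrArg κ (hc (k - j) (by omega))
        simpa [w, show j + 2 ≠ k + 4 by omega, show j + 1 ≠ k + 3 by omega,
          show j ≠ k + 2 by omega, show j ≠ k + 1 by omega,
          show k + 3 - (j + 2) = k - j + 1 by omega,
          show k + 3 - (j + 2 + 1) = k - j by omega] using this
      · have := congrArg (fun a => κ (ι a)) hxy
        simpa [w, hc0] using this
  obtain ⟨f, hf⟩ := HigmanGroup.exists_hom (fun i : ZMod (k + 5) => w i.val) (by
    intro i
    rcases ZMod.eq_neg_one_or_val_add_one i with rfl | ⟨hi, hi'⟩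
    · have := congrArg (fun a => κ (ι a)) hyz
      simpa [w, ZMod.val_neg_one] using this
    · rw [hi']
      exact hw _ hi)
  refine ⟨G, _, κ.comp ι, f, hκ.comp hι, by simp [hf, w], ?_⟩
  have h2 : (-2 : ZMod (k + 5)).val = k + 3 := by
    have : (-2 : ZMod (k + 5)) = ((k + 3 : ℕ) : ZMod (k + 5)) := by
      have := ZMod.natCast_self (k + 5)
      push_cast at this ⊢
      linear_combination -this
    rw [this, ZMod.val_natCast_of_lt (by omega)]
  simp [hf, w, h2, hc0]

open Equiv in
lemma exists_metabelian_triple : ∃ x y z : Perm (ℝ × ℝ), x * y * x⁻¹ = y ^ 2 ∧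
    y * z * y⁻¹ = z ^ 2 ∧ ZPowersIndependent z x ∧ Commute z (x * z * x⁻¹) := by
  let x : Perm (ℝ × ℝ) := (Equiv.mulLeft₀ 2 two_ne_zero).prodCongr (Equiv.refl ℝ)
  let y : Perm (ℝ × ℝ) := (Equiv.addRight 1).prodCongr (Equiv.refl ℝ)
  let shear : (ℝ → ℝ) → Perm (ℝ × ℝ) := fun u =>
    { toFun := fun p => (p.1, p.2 + u p.1)
      invFun := fun p => (p.1, p.2 - u p.1)
      left_inv := fun p => by simp
      right_inv := fun p => by simp }
  let z := shear fun t => 2 ^ (-t)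
  have hxz : x * z * x⁻¹ = shear fun t => 2 ^ (-(t / 2)) := by
    rw [mul_inv_eq_iff_eq_mul]
    ext p <;> simp [x, z, shear]
  refine ⟨x, y, z, ?_, ?_, ?_, ?_⟩
  · rw [mul_inv_eq_iff_eq_mul]
    ext p <;> simp [x, y, pow_two]
    ring
  · rw [mul_inv_eq_iff_eq_mul]
    ext p
    · simp [y, z, shear, pow_two]
    · simp [y, z, shear, pow_two, Real.rpow_add]
      ring
  · intro i j hij
    have hz : ∀ (n : ℤ) (p : ℝ × ℝ), (z ^ n) p = (p.1, p.2 + n * 2 ^ (-p.1)) := by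
      intro n
      induction n using Int.induction_on with
      | zero => simp
      | succ n ih =>
        intro p
        rw [zpow_add_one, Equiv.Perm.mul_apply, ih]
        simp [z, shear]
        ring
      | pred n ih =>
        intro p
        rw [zpow_sub_one, Equiv.Perm.mul_apply, ih]
        simp [z, shear, Equiv.Perm.inv_def, Equiv.symm]
        ring
    have hx : ∀ (n : ℤ) (p : ℝ × ℝ), (x ^ n) p = (2 ^ n * p.1, p.2) := by
      intro n
      induction n using Int.induction_on with
      | zero => simp
      | succ n ih =>
        intro p
        rw [zpow_add_one, Equiv.Perm.mul_apply, ih, zpow_add_one₀ two_ne_zero, mul_assoc]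
        rfl
      | pred n ih =>
        intro p
        rw [zpow_sub_one, Equiv.Perm.mul_apply, ih, zpow_sub_one₀ two_ne_zero, mul_assoc]
        rfl
    have hp := congrArg (fun σ : Perm (ℝ × ℝ) => σ (1, 0)) hij
    simp only [hz, hx, Prod.mk.injEq, mul_one, zero_add] at hp
    refine ⟨?_, (zpow_eq_one_iff_right₀ (by norm_num) (by norm_num)).1 hp.1.symm⟩
    have : (2 : ℝ) ^ (-1 : ℝ) ≠ 0 := by positivity
    simpa [this] using hp.2
  · rw [hxz]
    ext p <;> simp [z, shear]
    ring

open Equiv in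
lemma exists_finite_triple : ∃ x y z : Perm (Fin 7), x * y * x⁻¹ = y ^ 2 ∧
    y * z * y⁻¹ = z ^ 2 ∧ ¬ Commute z (x * z * x⁻¹) := by
  refine ⟨swap 2 4 * swap 5 6, c[1, 2, 4] * c[3, 6, 5], finRotate 7, ?_, ?_, ?_⟩
  · decide
  · decide
  · unfold Commute SemiconjBy
    decide

theorem higman_not_simple (n : ℕ) (hn : 5 ≤ n) :
    ∃ N : Subgroup (HigmanGroup n), N.Normal ∧ N ≠ ⊥ ∧ N ≠ ⊤ := by
  obtain ⟨k, rfl⟩ := Nat.exists_eq_add_of_le' hn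
  obtain ⟨x, y, z, hxy, hyz, hind, hcomm⟩ := exists_metabelian_triple
  obtain ⟨x', y', z', hxy', hyz', hcomm'⟩ := exists_finite_triple
  obtain ⟨G, _, ι, f, hι, hf0, hf2⟩ := HigmanGroup.exists_hom_extension k hxy hyz hind
  obtain ⟨G', _, ι', f', hι', hf0', hf2'⟩ :=
    HigmanGroup.exists_hom_extension k (x := (x, x')) (y := (y, y')) (z := (z, z'))
      (Prod.ext hxy hxy') (Prod.ext hyz hyz')
      (fun i j hij => hind i j (congrArg Prod.fst hij))
  refine ⟨f.ker, inferInstance, fun hbot => ?_, fun htop => ?_⟩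
  · let a : HigmanGroup (k + 5) := .gen 0
    let b : HigmanGroup (k + 5) := .gen (-2)
    have hab : Commute a (b * a * b⁻¹) := by
      apply (f.ker_eq_bot_iff.1 hbot)
      simpa [a, b, hf0, hf2] using congrArg ι hcomm.eq
    have hQ : Commute (z, z') ((x, x') * (z, z') * (x, x')⁻¹) := by
      apply hι'
      simpa only [a, b, map_mul, map_inv, hf0', hf2'] using congrArg f' hab.eq
    exact hcomm' (congrArg Prod.snd hQ.eq)
  · have hz : ι z = 1 := by
      rw [← hf0]
      exact f.mem_ker.1 (htop ▸ Subgroup.mem_top _)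
    rw [hι.eq_iff' (map_one _)] at hz
    exact one_ne_zero (hind 1 0 (by simp [hz])).1
end
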